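/- arXiv:0806.0492 — 3 statements merged into one kernel-verified Lean document; each statement's English description precedes it below -/
import Mathlib

section
/- Let f ∈ C²([0,∞)) be nondecreasing and convex with f > 0 on (0,∞), assume q₀ = lim_{u→0⁺} q(u) exists with q₀ < +∞, and let p₀ be its conjugate exponent. Then there exists no function u ∈ C²(ℝ^N) ∩ L^∞(ℝ^N) with u > 0 satisfying the differential inequality −Δu ≤ f(u) in ℝ^N together with the stability inequality ∫_{ℝ^N} f'(u)φ² dx ≤ ∫_{ℝ^N} |∇φ|² dx for all φ ∈ C¹_c(ℝ^N), if either (1) 1 ≤ N ≤ 9, or (2) N = 10 and p₀ < +∞, or (3) N ≥ 11 and p₀ < p_c(N). -/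
open MeasureTheory Filter Topology
open scoped ENNReal

/-- The Laplacian of `u : ℝ^N → ℝ`. -/
noncomputable def lap {N : ℕ} (u : EuclideanSpace ℝ (Fin N) → ℝ)
    (x : EuclideanSpace ℝ (Fin N)) : ℝ :=
  ∑ i : Fin N, iteratedFDeriv ℝ 2 u x ![EuclideanSpace.single i 1, EuclideanSpace.single i 1]

/-- `u` is a stable solution w.r.t. the linearized weight `g = f'`:
`∫ f'(u) φ² ≤ ∫ |∇φ|²` for all `φ ∈ C¹_c(ℝ^N)`. -/
def Stable {N : ℕ} (g : ℝ → ℝ) (u : EuclideanSpace ℝ (Fin N) → ℝ) : Prop :=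
  ∀ φ : EuclideanSpace ℝ (Fin N) → ℝ, ContDiff ℝ 1 φ → HasCompactSupport φ →
    ∫ x, g (u x) * (φ x) ^ 2 ≤ ∫ x, ‖gradient φ x‖ ^ 2

/-- `u` is stable outside the set `K` : the stability inequality holds for all
`φ ∈ C¹_c(ℝ^N \ K)`. -/
def StableOutside {N : ℕ} (g : ℝ → ℝ) (u : EuclideanSpace ℝ (Fin N) → ℝ)
    (K : Set (EuclideanSpace ℝ (Fin N))) : Prop :=
  ∀ φ : EuclideanSpace ℝ (Fin N) → ℝ, ContDiff ℝ 1 φ → HasCompactSupport φ →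
    tsupport φ ⊆ Kᶜ →
    ∫ x, g (u x) * (φ x) ^ 2 ≤ ∫ x, ‖gradient φ x‖ ^ 2

/-- The quantity `q(u) = f'(u)²/(f(u) f''(u)) ∈ [0,∞]`, with the convention
`q(u) = +∞` when `f(u) f''(u) = 0`. -/
noncomputable def qfun (f : ℝ → ℝ) (t : ℝ) : ℝ≥0∞ :=
  if f t * deriv (deriv f) t = 0 then ⊤
  else ENNReal.ofReal ((deriv f t) ^ 2 / (f t * deriv (deriv f) t))

/-- The Joseph–Lundgren exponent `p_c(N)` (for `N ≥ 11`). -/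
noncomputable def pc (N : ℕ) : ℝ :=
  (((N : ℝ) - 2) ^ 2 - 4 * N + 8 * Real.sqrt ((N : ℝ) - 1)) / (((N : ℝ) - 2) * ((N : ℝ) - 10))


/-- Green's formula for the Laplacian against a compactly supported `C¹` function. -/
theorem integral_lap_mul {N : ℕ} {u v : EuclideanSpace ℝ (Fin N) → ℝ} (hu : ContDiff ℝ 2 u)
    (hv : ContDiff ℝ 1 v) (hvc : HasCompactSupport v) :
    ∫ x, lap u x * v x = -∫ x, inner ℝ (gradient u x) (gradient v x) := by
  have hdu : ContDiff ℝ 1 (fderiv ℝ u) := hu.fderiv_right (by norm_num)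
  have hdv : Continuous (fderiv ℝ v) := hv.continuous_fderiv (by norm_num)
  have hui (i : Fin N) : ContDiff ℝ 1 fun x => fderiv ℝ u x (EuclideanSpace.single i 1) :=
    hdu.clm_apply contDiff_const
  have hlap (x) : lap u x = ∑ i : Fin N, fderiv ℝ (fun y => fderiv ℝ u y
      (EuclideanSpace.single i 1)) x (EuclideanSpace.single i 1) := by
    refine Finset.sum_congr rfl fun i _ => ?_
    rw [iteratedFDeriv_two_apply, fderiv_clm_apply (hdu.differentiable (by norm_num) x)
      (differentiableAt_const _)]
    simp
  have hinner (x) : inner ℝ (gradient u x) (gradient v x) = ∑ i : Fin N,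
      fderiv ℝ u x (EuclideanSpace.single i 1) * fderiv ℝ v x (EuclideanSpace.single i 1) := by
    rw [← (EuclideanSpace.basisFun (Fin N) ℝ).sum_inner_mul_inner]
    refine Finset.sum_congr rfl fun i _ => ?_
    rw [real_inner_comm (gradient v x)]
    simp [gradient, InnerProductSpace.toDual_symm_apply]
  have hI1 (i : Fin N) : Integrable fun x => fderiv ℝ (fun y => fderiv ℝ u y
      (EuclideanSpace.single i 1)) x (EuclideanSpace.single i 1) * v x :=
    ((((hui i).continuous_fderiv (by norm_num)).clm_apply continuous_const).mul
      hv.continuous).integrable_of_hasCompactSupport hvc.mul_left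
  have hI2 (i : Fin N) : Integrable fun x => fderiv ℝ u x (EuclideanSpace.single i 1) *
      fderiv ℝ v x (EuclideanSpace.single i 1) :=
    ((hui i).continuous.mul (hdv.clm_apply continuous_const)).integrable_of_hasCompactSupport
      (HasCompactSupport.mul_left (hvc.fderiv_apply (𝕜 := ℝ) _))
  have hI3 (i : Fin N) : Integrable fun x => fderiv ℝ u x (EuclideanSpace.single i 1) * v x :=
    ((hui i).continuous.mul hv.continuous).integrable_of_hasCompactSupport hvc.mul_left
  simp_rw [hlap, hinner, Finset.sum_mul]
  rw [integral_finsetSum _ fun i _ => hI1 i, integral_finsetSum _ fun i _ => hI2 i,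
    ← Finset.sum_neg_distrib]
  refine Finset.sum_congr rfl fun i _ => ?_
  rw [integral_mul_fderiv_eq_neg_fderiv_mul_of_integrable (hI1 i) (hI2 i) (hI3 i)
    (fun x _ => (hui i).differentiable (by norm_num) x)
      (fun x _ => hv.differentiable (by norm_num) x), neg_neg]

theorem gradient_eq_toDual_symm {E : Type*} [NormedAddCommGroup E] [InnerProductSpace ℝ E]
    [CompleteSpace E] (φ : E → ℝ) (x : E) :
    gradient φ x = (InnerProductSpace.toDual ℝ E).symm (fderiv ℝ φ x) := rfl

theorem norm_gradient {E : Type*} [NormedAddCommGroup E] [InnerProductSpace ℝ E]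
    [CompleteSpace E] (φ : E → ℝ) (x : E) : ‖gradient φ x‖ = ‖fderiv ℝ φ x‖ := by
  rw [gradient_eq_toDual_symm, LinearIsometryEquiv.norm_map]

theorem continuous_gradient {E : Type*} [NormedAddCommGroup E] [InnerProductSpace ℝ E]
    [CompleteSpace E] {φ : E → ℝ} (h : ContDiff ℝ 1 φ) : Continuous (gradient φ) :=
  (LinearIsometryEquiv.continuous _).comp (h.continuous_fderiv (by norm_num))

theorem gradient_comp_mul {E : Type*} [NormedAddCommGroup E] [InnerProductSpace ℝ E]
    [CompleteSpace E] {u ψ : E → ℝ} {α : ℝ → ℝ} {α' : ℝ} {x : E} (hα : HasDerivAt α α' (u x))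
    (hu : DifferentiableAt ℝ u x) (hψ : DifferentiableAt ℝ ψ x) :
    gradient (fun y => α (u y) * ψ y) x =
      (α' * ψ x) • gradient u x + α (u x) • gradient ψ x := by
  have h : HasFDerivAt (fun y => α (u y) * ψ y)
      ((α' * ψ x) • fderiv ℝ u x + α (u x) • fderiv ℝ ψ x) x := by
    refine ((hα.comp_hasFDerivAt x hu.hasFDerivAt).mul hψ.hasFDerivAt).congr_fderiv ?_
    ext v
    simp
    ring
  simp only [gradient_eq_toDual_symm, h.fderiv, map_add, map_smulₛₗ]
  simp

theorem contDiff_one_comp_of_pos {E : Type*} [NormedAddCommGroup E] [NormedSpace ℝ E]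
    {u : E → ℝ} {α α' : ℝ → ℝ} (hu : ContDiff ℝ 1 u) (hpos : ∀ x, 0 < u x)
    (hα : ∀ t, 0 < t → HasDerivAt α (α' t) t) (hc : ContinuousOn α' (Set.Ioi 0)) :
    ContDiff ℝ 1 fun x => α (u x) := by
  have h : ContDiffOn ℝ 1 α (Set.Ioi 0) := by
    rw [show (1 : WithTop ℕ∞) = 0 + 1 by simp, contDiffOn_succ_iff_deriv_of_isOpen isOpen_Ioi]
    refine ⟨fun t ht => (hα t ht).differentiableAt.differentiableWithinAt, by simp, ?_⟩
    exact contDiffOn_zero.2 (hc.congr fun t ht => (hα t ht).deriv)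
  exact h.comp_contDiff hu hpos

theorem HasCompactSupport.gradient {E : Type*} [NormedAddCommGroup E] [InnerProductSpace ℝ E]
    [CompleteSpace E] {φ : E → ℝ} (h : HasCompactSupport φ) : HasCompactSupport (gradient φ) :=
  (h.fderiv (𝕜 := ℝ)).comp_left (g := (InnerProductSpace.toDual ℝ E).symm) (map_zero _)

theorem HasCompactSupport.norm_gradient_sq {E : Type*} [NormedAddCommGroup E]
    [InnerProductSpace ℝ E] [CompleteSpace E] {φ : E → ℝ} (h : HasCompactSupport φ) :
    HasCompactSupport fun x => ‖_root_.gradient φ x‖ ^ 2 :=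
  h.gradient.comp_left (g := fun t => ‖t‖ ^ 2) (by simp)

theorem integrable_inner_gradient {N : ℕ} {u v : EuclideanSpace ℝ (Fin N) → ℝ}
    (hu : ContDiff ℝ 1 u) (hv : ContDiff ℝ 1 v) (hvc : HasCompactSupport v) :
    Integrable fun x => inner ℝ (gradient u x) (gradient v x) := by
  refine ((continuous_gradient hu).inner
    (continuous_gradient hv)).integrable_of_hasCompactSupport ?_
  refine HasCompactSupport.mono' hvc.gradient (Function.support_subset_iff'.2 fun x hx => ?_)
  have : gradient v x = 0 := image_eq_zero_of_notMem_tsupport hx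
  rw [this, inner_zero_right]

theorem integrable_norm_gradient_sq {N : ℕ} {φ : EuclideanSpace ℝ (Fin N) → ℝ}
    (hφ : ContDiff ℝ 1 φ) (hc : HasCompactSupport φ) :
    Integrable fun x => ‖gradient φ x‖ ^ 2 :=
  ((continuous_gradient hφ).norm.pow 2).integrable_of_hasCompactSupport hc.norm_gradient_sq

theorem norm_smul_add_smul_sq_le {E : Type*} [NormedAddCommGroup E] [NormedSpace ℝ E]
    (a b p η : ℝ) (hη : 0 < η) (v w : E) :
    ‖(a * p) • v + b • w‖ ^ 2 ≤
      (1 + η) * ((a ^ 2 * ‖v‖ ^ 2) * p ^ 2) + (1 + 1 / η) * (b ^ 2 * ‖w‖ ^ 2) := by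
  have hn := norm_add_le ((a * p) • v) (b • w)
  have h2 : ‖(a * p) • v‖ ^ 2 = (a ^ 2 * ‖v‖ ^ 2) * p ^ 2 := by
    rw [norm_smul, mul_pow, Real.norm_eq_abs, sq_abs]; ring
  have h3 : ‖b • w‖ ^ 2 = b ^ 2 * ‖w‖ ^ 2 := by
    rw [norm_smul, mul_pow, Real.norm_eq_abs, sq_abs]
  rw [← h2, ← h3]
  refine (pow_le_pow_left₀ (norm_nonneg _) hn 2).trans ?_
  generalize ‖(a * p) • v‖ = A
  generalize ‖b • w‖ = B
  have h4 : (1 + η) * A ^ 2 + (1 + 1 / η) * B ^ 2 - (A + B) ^ 2 = (η * A - B) ^ 2 / η := by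
    field_simp; ring
  have h5 : 0 ≤ (η * A - B) ^ 2 / η := by positivity
  linarith

theorem sub_le_inner_smul_add_smul {E : Type*} [NormedAddCommGroup E] [InnerProductSpace ℝ E]
    (a b p k η : ℝ) (hη : 0 < η) (hk : 0 ≤ k) (hkab : k ≤ b * a) (v w : E) :
    (1 - η) * ((a ^ 2 * ‖v‖ ^ 2) * p ^ 2) - 1 / η * (b ^ 2 * ‖w‖ ^ 2) ≤
      inner ℝ v ((a ^ 2 * p ^ 2) • v + k • ((2 * p) • w)) := by
  rw [inner_add_right, real_inner_smul_right, real_inner_smul_right, real_inner_smul_right,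
    real_inner_self_eq_norm_sq]
  have hin := abs_real_inner_le_norm v w
  generalize inner ℝ v w = I at *
  have hab : 0 ≤ b * a := hk.trans hkab
  have h1 : |k * (2 * p * I)| ≤ 2 * ((b * a) * |p| * (‖v‖ * ‖w‖)) := by
    rw [abs_mul, abs_of_nonneg hk, abs_mul, abs_mul, abs_two]
    calc _ = 2 * (k * |p| * |I|) := by ring
      _ ≤ _ := by gcongr
  generalize ‖v‖ = P at *
  generalize ‖w‖ = Q at *
  have h2 := neg_abs_le (k * (2 * p * I))
  have h3 : η * (a ^ 2 * P ^ 2 * p ^ 2) + 1 / η * (b ^ 2 * Q ^ 2) -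
      2 * ((b * a) * |p| * (P * Q)) = (η * (a * P * |p|) - b * Q) ^ 2 / η := by
    rw [← sq_abs p]; field_simp; ring
  have h4 : 0 ≤ (η * (a * P * |p|) - b * Q) ^ 2 / η := by positivity
  linarith

/-- A weighted stability estimate: for a stable solution of `-Δu ≤ f(u)`, testing stability
with `α(u)ψ` and the differential inequality with `K(u)ψ²`, where `K' = α'²`. -/
theorem Stable.exists_integral_le {N : ℕ} {f g α α' K : ℝ → ℝ}
    {u : EuclideanSpace ℝ (Fin N) → ℝ} {M δ : ℝ} (hst : Stable g u) (hu : ContDiff ℝ 2 u)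
    (hpos : ∀ x, 0 < u x) (hM : ∀ x, u x ≤ M) (hineq : ∀ x, -lap u x ≤ f (u x))
    (hf : ContinuousOn f (Set.Ioi 0)) (hg : ContinuousOn g (Set.Ioi 0))
    (hα : ∀ t, 0 < t → HasDerivAt α (α' t) t) (hα'c : ContinuousOn α' (Set.Ioi 0))
    (hK : ∀ t, 0 < t → HasDerivAt K (α' t ^ 2) t) (hK0 : ∀ t, 0 < t → 0 ≤ K t)
    (hKα : ∀ t, 0 < t → t ≤ M → K t ≤ α t * α' t) (hδ : 0 < δ) (hδ1 : δ ≤ 1)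
    (hfK : ∀ t, 0 < t → t ≤ M → f t * K t ≤ (1 - δ) * (g t * α t ^ 2)) :
    ∃ C, 0 < C ∧ ∀ ψ : EuclideanSpace ℝ (Fin N) → ℝ, ContDiff ℝ 1 ψ → HasCompactSupport ψ →
      ∫ x, g (u x) * α (u x) ^ 2 * ψ x ^ 2 ≤ C * ∫ x, α (u x) ^ 2 * ‖gradient ψ x‖ ^ 2 := by
  refine ⟨(1 + 2 * (4 / δ)) / (δ / 2), by positivity, fun ψ hψ hψc => ?_⟩
  have hu1 : ContDiff ℝ 1 u := hu.of_le (by norm_num)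
  have hαu := contDiff_one_comp_of_pos hu1 hpos hα hα'c
  have hKu := contDiff_one_comp_of_pos hu1 hpos hK (hα'c.pow 2)
  have hα'u : Continuous fun x => α' (u x) := hα'c.comp_continuous hu.continuous hpos
  have hfu : Continuous fun x => f (u x) := hf.comp_continuous hu.continuous hpos
  have hgu : Continuous fun x => g (u x) := hg.comp_continuous hu.continuous hpos
  have hdu := continuous_gradient hu1
  have hdψ := continuous_gradient hψ
  have hψ2c : HasCompactSupport fun x => ψ x ^ 2 :=
    hψc.comp_left (g := fun t : ℝ => t ^ 2) (by simp)
  have hS : Integrable fun x => g (u x) * α (u x) ^ 2 * ψ x ^ 2 :=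
    ((hgu.mul (hαu.continuous.pow 2)).mul (hψ.continuous.pow 2)).integrable_of_hasCompactSupport
      hψ2c.mul_left
  have hG : Integrable fun x => (α' (u x) ^ 2 * ‖gradient u x‖ ^ 2) * ψ x ^ 2 :=
    (((hα'u.pow 2).mul (hdu.norm.pow 2)).mul
      (hψ.continuous.pow 2)).integrable_of_hasCompactSupport hψ2c.mul_left
  have hD : Integrable fun x => α (u x) ^ 2 * ‖gradient ψ x‖ ^ 2 :=
    ((hαu.continuous.pow 2).mul (hdψ.norm.pow 2)).integrable_of_hasCompactSupport hψc.norm_gradient_sq.mul_left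
  have key1 : ∫ x, g (u x) * α (u x) ^ 2 * ψ x ^ 2 ≤
      (1 + δ / 4) * (∫ x, (α' (u x) ^ 2 * ‖gradient u x‖ ^ 2) * ψ x ^ 2) +
      (1 + 1 / (δ / 4)) * ∫ x, α (u x) ^ 2 * ‖gradient ψ x‖ ^ 2 := by
    have h1 := hst (fun x => α (u x) * ψ x) (hαu.mul hψ) hψc.mul_left
    rw [← integral_const_mul, ← integral_const_mul,
      ← integral_add (hG.const_mul _) (hD.const_mul _)]
    simp_rw [mul_pow, ← mul_assoc] at h1
    refine h1.trans (integral_mono (integrable_norm_gradient_sq (hαu.mul hψ) hψc.mul_left)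
      ((hG.const_mul _).add (hD.const_mul _)) fun x => ?_)
    simp only []
    rw [gradient_comp_mul (hα _ (hpos x)) (hu1.differentiable (by norm_num) x)
      (hψ.differentiable (by norm_num) x)]
    exact norm_smul_add_smul_sq_le _ _ _ _ (by positivity) _ _
  have key2 : (1 - δ / 4) * (∫ x, (α' (u x) ^ 2 * ‖gradient u x‖ ^ 2) * ψ x ^ 2) -
      1 / (δ / 4) * (∫ x, α (u x) ^ 2 * ‖gradient ψ x‖ ^ 2) ≤
      (1 - δ) * ∫ x, g (u x) * α (u x) ^ 2 * ψ x ^ 2 := by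
    have hv : ContDiff ℝ 1 fun x => K (u x) * ψ x ^ 2 := hKu.mul (hψ.pow 2)
    have hvc : HasCompactSupport fun x => K (u x) * ψ x ^ 2 := hψ2c.mul_left
    have hlapc : Continuous (lap u) := by
      have := hu.continuous_iteratedFDeriv (m := 2) (by norm_num)
      unfold lap
      fun_prop
    rw [← integral_const_mul, ← integral_const_mul, ← integral_const_mul,
      ← integral_sub (hG.const_mul _) (hD.const_mul _)]
    calc
      _ ≤ ∫ x, inner ℝ (gradient u x) (gradient (fun x => K (u x) * ψ x ^ 2) x) := by
        refine integral_mono ((hG.const_mul _).sub (hD.const_mul _))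
          (integrable_inner_gradient hu1 hv hvc) fun x => ?_
        have hψ2 : gradient (fun y => ψ y ^ 2) x = (2 * ψ x) • gradient ψ x := by
          have h := (hψ.differentiable (by norm_num) x).hasFDerivAt.pow 2
          simp only [gradient_eq_toDual_symm, h.fderiv, map_smulₛₗ]
          simp
        simp only []
        rw [gradient_comp_mul (hK _ (hpos x)) (hu1.differentiable (by norm_num) x)
          ((hψ.pow 2).differentiable (by norm_num) x), hψ2]
        exact sub_le_inner_smul_add_smul _ _ _ _ _ (by positivity) (hK0 _ (hpos x))
          (hKα _ (hpos x) (hM x)) _ _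
      _ = ∫ x, (-lap u x) * (K (u x) * ψ x ^ 2) := by
        simp_rw [neg_mul]
        rw [integral_neg, integral_lap_mul hu hv hvc, neg_neg]
      _ ≤ _ := by
        refine integral_mono ((hlapc.neg.mul hv.continuous).integrable_of_hasCompactSupport
          hvc.mul_left) (hS.const_mul _) fun x => ?_
        calc _ ≤ f (u x) * (K (u x) * ψ x ^ 2) :=
              mul_le_mul_of_nonneg_right (hineq x) (mul_nonneg (hK0 _ (hpos x)) (sq_nonneg _))
          _ = (f (u x) * K (u x)) * ψ x ^ 2 := by ring
          _ ≤ ((1 - δ) * (g (u x) * α (u x) ^ 2)) * ψ x ^ 2 :=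
              mul_le_mul_of_nonneg_right (hfK _ (hpos x) (hM x)) (sq_nonneg _)
          _ = _ := by ring
  have hD0 : 0 ≤ ∫ x, α (u x) ^ 2 * ‖gradient ψ x‖ ^ 2 := integral_nonneg fun x => by positivity
  generalize (∫ x, g (u x) * α (u x) ^ 2 * ψ x ^ 2) = S at *
  generalize (∫ x, (α' (u x) ^ 2 * ‖gradient u x‖ ^ 2) * ψ x ^ 2) = G at *
  generalize (∫ x, α (u x) ^ 2 * ‖gradient ψ x‖ ^ 2) = D at *
  rw [div_mul_eq_mul_div, le_div_iff₀ (by positivity)]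
  rcases le_or_gt S 0 with hS0 | hS0
  · exact (mul_nonpos_of_nonpos_of_nonneg hS0 (by positivity)).trans (by positivity)
  · have h1 := mul_le_mul_of_nonneg_left key1 (show 0 ≤ 1 - δ / 4 by linarith)
    have h2 := mul_le_mul_of_nonneg_left key2 (show 0 ≤ 1 + δ / 4 by linarith)
    have h3 : 0 ≤ δ ^ 2 * S := by positivity
    have h5 : 4 / δ = 1 / (δ / 4) := by field_simp
    rw [h5]
    generalize 1 / (δ / 4) = c at *
    linear_combination h1 + h2 + h3 / 4 + δ / 4 * hD0

/-- Cutoff functions at scale `R`. -/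
theorem exists_cutoff (N : ℕ) : ∃ L : ℝ, 0 < L ∧ ∀ R : ℝ, 1 ≤ R →
    ∃ ζ : EuclideanSpace ℝ (Fin N) → ℝ, ContDiff ℝ 1 ζ ∧ HasCompactSupport ζ ∧
      (∀ x, 0 ≤ ζ x ∧ ζ x ≤ 1) ∧ (∀ x, ‖x‖ ≤ 1 → ζ x = 1) ∧ (∀ x, 2 * R ≤ ‖x‖ → ζ x = 0) ∧
      ∀ x, ‖gradient ζ x‖ ≤ L * R⁻¹ := by
  let Θ : ContDiffBump (0 : EuclideanSpace ℝ (Fin N)) := ⟨1, 2, by norm_num, by norm_num⟩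
  have hΘ1 : ContDiff ℝ 1 Θ := Θ.contDiff
  obtain ⟨L, hL⟩ := (continuous_gradient hΘ1).bounded_above_of_compact_support
    Θ.hasCompactSupport.gradient
  have hL0 : 0 ≤ L := (norm_nonneg _).trans (hL 0)
  refine ⟨L + 1, by linarith, fun R hR => ?_⟩
  have hR0 : 0 < R := by linarith
  refine ⟨fun x => Θ (R⁻¹ • x), hΘ1.comp (contDiff_const_smul _),
    Θ.hasCompactSupport.comp_smul (inv_ne_zero hR0.ne'), fun x => ⟨Θ.nonneg, Θ.le_one⟩,
    fun x hx => Θ.one_of_mem_closedBall ?_, fun x hx => Θ.zero_of_le_dist ?_, fun x => ?_⟩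
  · rw [mem_closedBall_zero_iff, norm_smul, Real.norm_of_nonneg (by positivity)]
    have : R⁻¹ ≤ 1 := inv_le_one_of_one_le₀ hR
    exact mul_le_one₀ this (norm_nonneg x) hx
  · rw [dist_zero_right, norm_smul, Real.norm_of_nonneg (by positivity), inv_mul_eq_div,
      le_div_iff₀ hR0]
    exact hx
  · have h1 : HasFDerivAt (fun x => Θ (R⁻¹ • x)) (R⁻¹ • fderiv ℝ Θ (R⁻¹ • x)) x := by
      have h2 := (hΘ1.differentiable (by norm_num) (R⁻¹ • x)).hasFDerivAt
      refine (h2.comp x ((hasFDerivAt_id x).const_smul R⁻¹)).congr_fderiv ?_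
      ext v; simp
    rw [norm_gradient, h1.fderiv, norm_smul, Real.norm_of_nonneg (by positivity), mul_comm,
      ← norm_gradient]
    gcongr
    exact (hL _).trans (by linarith)

theorem mul_rpow_neg_two_le {A y a b s z R η : ℝ} {m : ℕ} (hA0 : 0 < A) (hy0 : 0 < y)
    (hAy : A ≤ y ^ (2 * a)) (hs : b * (s / 2) = 2 * a) (hs0 : 0 < s) (hz0 : 0 ≤ z)
    (hz1 : z ≤ 1) (hR : 0 < R) (hη : 0 < η) (hm : 1 + s / 2 ≤ m) :
    A * (z ^ (2 * (m - 1)) * R ^ (-2 : ℝ)) ≤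
      η * (y ^ b * A * (z ^ m) ^ 2) + η⁻¹ ^ (s / 2) * R ^ (-2 - s) := by
  obtain ⟨k, rfl⟩ : ∃ k, m = k + 1 := by
    refine ⟨m - 1, (Nat.sub_add_cancel ?_).symm⟩
    have : (1 : ℝ) ≤ m := by linarith
    exact_mod_cast this
  rw [Nat.add_sub_cancel]
  push_cast at hm
  rcases le_or_gt (R ^ (-2 : ℝ)) (η * (y ^ b * z ^ 2)) with h | h
  · calc _ ≤ A * (z ^ (2 * k) * (η * (y ^ b * z ^ 2))) := by gcongr
      _ = η * (y ^ b * A * (z ^ (k + 1)) ^ 2) := by ring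
      _ ≤ _ := le_add_of_nonneg_right (by positivity)
  · have h1 : y ^ b * z ^ 2 ≤ η⁻¹ * R ^ (-2 : ℝ) := by
      rw [inv_mul_eq_div, le_div_iff₀ hη]; linarith
    have h2 : z ^ (2 * k) ≤ z ^ s := by
      rw [← Real.rpow_natCast]
      refine Real.rpow_le_rpow_of_exponent_ge' hz0 hz1 hs0.le ?_
      push_cast; linarith
    have h3 : y ^ (2 * a) * z ^ s = (y ^ b * z ^ 2) ^ (s / 2) := by
      rw [Real.mul_rpow (by positivity) (by positivity), ← Real.rpow_mul hy0.le, hs,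
        ← Real.rpow_natCast z, ← Real.rpow_mul hz0]
      congr 2; push_cast; ring
    have h4 : (η⁻¹ * R ^ (-2 : ℝ)) ^ (s / 2) * R ^ (-2 : ℝ) =
        η⁻¹ ^ (s / 2) * R ^ (-2 - s) := by
      rw [Real.mul_rpow (by positivity) (by positivity), ← Real.rpow_mul hR.le, mul_assoc,
        ← Real.rpow_add hR]
      congr 2; ring
    calc _ = (A * z ^ (2 * k)) * R ^ (-2 : ℝ) := by ring
      _ ≤ (y ^ (2 * a) * z ^ s) * R ^ (-2 : ℝ) := by gcongr
      _ ≤ (η⁻¹ * R ^ (-2 : ℝ)) ^ (s / 2) * R ^ (-2 : ℝ) := by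
        rw [h3]; gcongr
      _ = _ := h4
      _ ≤ _ := le_add_of_nonneg_left (by positivity)

/-- A Caccioppoli-type inequality with a superlinear weight has no positive solution in low
dimension. -/
theorem false_of_integral_le {N : ℕ} {y A : EuclideanSpace ℝ (Fin N) → ℝ} {a b C : ℝ}
    (hy : Continuous y) (hA : Continuous A) (hy0 : ∀ x, 0 < y x) (hA0 : ∀ x, 0 < A x)
    (hAy : ∀ x, A x ≤ y x ^ (2 * a)) (ha : 0 < a) (hb : 0 < b) (hC : 0 < C)
    (hN : (N : ℝ) < 2 + 4 * a / b)
    (h : ∀ ψ : EuclideanSpace ℝ (Fin N) → ℝ, ContDiff ℝ 1 ψ → HasCompactSupport ψ →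
      ∫ x, y x ^ b * A x * ψ x ^ 2 ≤ C * ∫ x, A x * ‖gradient ψ x‖ ^ 2) : False := by
  set s := 4 * a / b with hs
  have hs0 : 0 < s := by positivity
  obtain ⟨L, hL0, hcut⟩ := exists_cutoff N
  let χ : ContDiffBump (0 : EuclideanSpace ℝ (Fin N)) := ⟨1 / 2, 1, by norm_num, by norm_num⟩
  obtain ⟨m, hm⟩ := exists_nat_ge (1 + s / 2)
  have hm2 : 2 ≤ m := by
    have : (1 : ℝ) < m := by linarith
    exact_mod_cast this
  set D : ℝ := (m * L) ^ 2 with hD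
  have hD0 : 0 < D := by positivity
  set η : ℝ := 1 / (2 * (C * D)) with hη
  have hη0 : 0 < η := by positivity
  have hyb : Continuous fun x => y x ^ b := hy.rpow_const fun x => Or.inl (hy0 x).ne'
  set x0 := ∫ x, y x ^ b * A x * χ x with hx0
  have hx0pos : 0 < x0 := by
    refine ((hyb.mul hA).mul χ.continuous).integral_pos_of_hasCompactSupport_nonneg_nonzero
      (x := 0) χ.hasCompactSupport.mul_left (fun x => ?_) ?_
    · have := hy0 x; have := hA0 x; have := χ.nonneg (x := x)
      simp only [Pi.zero_apply]
      positivity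
    · have h1 : χ 0 = 1 := χ.one_of_mem_closedBall (by simp [χ])
      have := hy0 0; have := hA0 0
      simp only [h1]
      positivity
  set V : ℝ := (volume (Metric.closedBall (0 : EuclideanSpace ℝ (Fin N)) 1)).toReal with hV
  set C' : ℝ := 2 * (C * (D * (η⁻¹) ^ (s / 2))) * (2 ^ N * V) with hC'
  have main : ∀ R : ℝ, 1 ≤ R → x0 ≤ C' * R ^ ((N : ℝ) - 2 - s) := by
    intro R hR
    have hR0 : 0 < R := by linarith
    obtain ⟨ζ, hζ1, hζc, hζ01, hζone, hζzero, hgζ⟩ := hcut R hR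
    set ψ : EuclideanSpace ℝ (Fin N) → ℝ := fun x => ζ x ^ m with hψ
    have hψ1 : ContDiff ℝ 1 ψ := hζ1.pow m
    have hψc : HasCompactSupport ψ :=
      hζc.comp_left (g := fun t : ℝ => t ^ m) (zero_pow (by omega))
    have hψ2c : HasCompactSupport fun x => ψ x ^ 2 :=
      hψc.comp_left (g := fun t : ℝ => t ^ 2) (by simp)
    have hgψ (x) : ‖gradient ψ x‖ ^ 2 ≤ D * ζ x ^ (2 * (m - 1)) * R ^ (-2 : ℝ) := by
      have h1 : HasFDerivAt ψ ((m * ζ x ^ (m - 1)) • fderiv ℝ ζ x) x := by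
        refine ((hζ1.differentiable (by norm_num) x).hasFDerivAt.pow m).congr_fderiv ?_
        ext v; simp
      have h2 : R ^ (-2 : ℝ) = R⁻¹ ^ 2 := by
        rw [Real.rpow_neg hR0.le, inv_pow]; norm_num
      have := (hζ01 x).1
      have := hgζ x
      rw [norm_gradient, h1.fderiv, norm_smul, Real.norm_of_nonneg (by positivity),
        ← norm_gradient, h2, hD, pow_mul', ← mul_pow, ← mul_pow]
      refine pow_le_pow_left₀ (by positivity) ?_ 2
      calc _ ≤ (m * ζ x ^ (m - 1)) * (L * R⁻¹) := by gcongr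
        _ = _ := by ring
    have hpt (x) : A x * ‖gradient ψ x‖ ^ 2 ≤ D * η * (y x ^ b * A x * ψ x ^ 2) +
        (Metric.closedBall (0 : EuclideanSpace ℝ (Fin N)) (2 * R)).indicator
          (fun _ => D * (η⁻¹) ^ (s / 2) * R ^ (-2 - s)) x := by
      have hx := hA0 x
      have hy' := hy0 x
      rcases le_or_gt ‖x‖ (2 * R) with hxR | hxR
      · rw [Set.indicator_of_mem (by simpa using hxR)]
        have h1 := mul_rpow_neg_two_le hx hy' (hAy x) (s := s) (b := b) (m := m) (R := R)
          (η := η) (by rw [hs]; field_simp; ring) hs0 (hζ01 x).1 (hζ01 x).2 hR0 hη0 hm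
        calc _ ≤ A x * (D * ζ x ^ (2 * (m - 1)) * R ^ (-2 : ℝ)) := by gcongr; exact hgψ x
          _ = D * (A x * (ζ x ^ (2 * (m - 1)) * R ^ (-2 : ℝ))) := by ring
          _ ≤ D * _ := mul_le_mul_of_nonneg_left h1 hD0.le
          _ = _ := by ring
      · have h1 : ‖gradient ψ x‖ ^ 2 ≤ 0 := by
          have := hgψ x
          rwa [hζzero x hxR.le, zero_pow (by omega), mul_zero, zero_mul] at this
        rw [Set.indicator_of_notMem (by simpa using hxR), add_zero]
        exact (mul_nonpos_of_nonneg_of_nonpos hx.le h1).trans (by positivity)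
    have hI : Integrable fun x => y x ^ b * A x * ψ x ^ 2 :=
      ((hyb.mul hA).mul (hψ1.continuous.pow 2)).integrable_of_hasCompactSupport
        hψ2c.mul_left
    have hI2 : Integrable ((Metric.closedBall (0 : EuclideanSpace ℝ (Fin N)) (2 * R)).indicator
          (fun _ => D * (η⁻¹) ^ (s / 2) * R ^ (-2 - s))) := by
      rw [integrable_indicator_iff Metric.isClosed_closedBall.measurableSet]
      exact integrableOn_const (measure_closedBall_lt_top.ne)
    have hvol : (volume (Metric.closedBall (0 : EuclideanSpace ℝ (Fin N)) (2 * R))).toReal =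
        (2 ^ N * V) * R ^ (N : ℝ) := by
      rw [Measure.addHaar_closedBall' _ _ (by positivity), ENNReal.toReal_mul,
        ENNReal.toReal_ofReal (by positivity), finrank_euclideanSpace_fin, Real.rpow_natCast,
        mul_pow]
      ring
    have h1 := h ψ hψ1 hψc
    have h2 : ∫ x, A x * ‖gradient ψ x‖ ^ 2 ≤ D * η * (∫ x, y x ^ b * A x * ψ x ^ 2) +
        (2 ^ N * V) * R ^ (N : ℝ) * (D * (η⁻¹) ^ (s / 2) * R ^ (-2 - s)) := by
      calc _ ≤ ∫ x, (D * η * (y x ^ b * A x * ψ x ^ 2) +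
        (Metric.closedBall (0 : EuclideanSpace ℝ (Fin N)) (2 * R)).indicator
          (fun _ => D * (η⁻¹) ^ (s / 2) * R ^ (-2 - s)) x) :=
            integral_mono ((hA.mul ((continuous_gradient hψ1).norm.pow
              2)).integrable_of_hasCompactSupport hψc.norm_gradient_sq.mul_left)
              ((hI.const_mul _).add hI2) hpt
        _ = _ := by
          rw [integral_add (hI.const_mul _) hI2, integral_const_mul, integral_indicator
            Metric.isClosed_closedBall.measurableSet, setIntegral_const, smul_eq_mul, ← hvol,
            measureReal_def]
    have h3 : x0 ≤ ∫ x, y x ^ b * A x * ψ x ^ 2 := by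
      refine integral_mono (((hyb.mul hA).mul χ.continuous).integrable_of_hasCompactSupport
        χ.hasCompactSupport.mul_left) hI fun x => ?_
      have hyA : 0 ≤ y x ^ b * A x := by
        have := hy0 x; have := hA0 x; positivity
      refine mul_le_mul_of_nonneg_left ?_ hyA
      rcases le_or_gt 1 ‖x‖ with hx | hx
      · rw [χ.zero_of_le_dist (by simpa using hx)]
        positivity
      · have : ζ x = 1 := hζone x hx.le
        rw [hψ]
        simp only [this, one_pow]
        exact χ.le_one
    have h4 : R ^ ((N : ℝ) - 2 - s) = R ^ (N : ℝ) * R ^ (-2 - s) := by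
      rw [← Real.rpow_add hR0]; ring_nf
    have h5 : C * (D * η) = 1 / 2 := by rw [hη]; field_simp
    rw [h4, hC']
    have h6 := mul_le_mul_of_nonneg_left h2 hC.le
    generalize (∫ x, y x ^ b * A x * ψ x ^ 2) = X at *
    linear_combination h3 + 2 * h1 + 2 * h6 + 2 * X * h5
  have hlim : Tendsto (fun R : ℝ => C' * R ^ ((N : ℝ) - 2 - s)) atTop (𝓝 (C' * 0)) := by
    have := tendsto_rpow_neg_atTop (y := 2 + s - N) (by linarith)
    refine Tendsto.const_mul _ (this.congr fun R => ?_)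
    congr 1; ring
  have := ge_of_tendsto hlim ((eventually_ge_atTop 1).mono main)
  linarith

/-- Near `0` the weight `α` is comparable to `f ^ (1 + σ)`, and away from `0` it is a multiple
of `f`; the function `K` is the primitive of `α'²` vanishing at `0`. -/
theorem exists_weights {f f₁ f₂ : ℝ → ℝ} {σ ρ ε : ℝ} (M : ℝ)
    (hf : ∀ t, 0 < t → HasDerivAt f (f₁ t) t) (hf₁ : ∀ t, 0 < t → HasDerivAt f₁ (f₂ t) t)
    (hf0 : ∀ t, 0 < t → 0 < f t) (hf₁0 : ∀ t, 0 < t → 0 < f₁ t) (hf₂0 : ∀ t, 0 < t → 0 ≤ f₂ t)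
    (hmono : MonotoneOn f (Set.Ioi 0)) (hmono₁ : MonotoneOn f₁ (Set.Ioi 0))
    (hσ : 0 < σ) (hρ : σ ^ 2 < ρ) (hε : 0 < ε)
    (hfρ : ∀ t, 0 < t → t ≤ ε → ρ * f₁ t ^ 2 ≤ f t * f₂ t) :
    ∃ (α α' K : ℝ → ℝ) (δ : ℝ), 0 < δ ∧ δ ≤ 1 ∧ (∀ t, 0 < t → HasDerivAt α (α' t) t) ∧
      ContinuousOn α' (Set.Ioi 0) ∧ (∀ t, 0 < t → HasDerivAt K (α' t ^ 2) t) ∧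
      (∀ t, 0 < t → 0 ≤ K t) ∧ (∀ t, 0 < t → K t ≤ α t * α' t) ∧
      (∀ t, 0 < t → t ≤ M → f t * K t ≤ (1 - δ) * (f₁ t * α t ^ 2)) ∧
      (∀ t, 0 < t → 0 < α t) ∧ ∀ t, 0 < t → α t ≤ f t ^ (1 + σ) := by
  set κ := f ε with hκ
  have hκ0 : 0 < κ := hf0 ε hε
  have hmax0 (s : ℝ) : 0 < max s κ := lt_max_of_lt_right hκ0
  have hBc : Continuous fun s : ℝ => (max s κ)⁻¹ :=
    (continuous_id.max continuous_const).inv₀ fun s => (hmax0 s).ne'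
  set B : ℝ → ℝ := fun s => ∫ r in (0 : ℝ)..s, (max r κ)⁻¹ with hB
  have hB' (s : ℝ) : HasDerivAt B (max s κ)⁻¹ s := hBc.integral_hasStrictDerivAt 0 s |>.hasDerivAt
  set c : ℝ → ℝ := fun t => 1 + σ - σ * (f t * (max (f t) κ)⁻¹) with hc
  set α : ℝ → ℝ := fun t => Real.exp ((1 + σ) * Real.log (f t) - σ * B (f t)) with hα
  set α' : ℝ → ℝ := fun t => c t * α t * f₁ t / f t with hα'
  set K : ℝ → ℝ := fun t => ∫ s in (0 : ℝ)..t, α' s ^ 2 with hK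
  set V : ℝ → ℝ := fun t => f₁ t * α t ^ 2 / f t with hV
  have hα0 (t) : 0 < α t := Real.exp_pos _
  have hαd (t) (ht : 0 < t) : HasDerivAt α (α' t) t := by
    have h0 := (hf0 t ht).ne'
    refine ((((hf t ht).log h0).const_mul (1 + σ)).sub
      (((hB' (f t)).comp t (hf t ht)).const_mul σ)).exp.congr_deriv ?_
    simp only [hα', hc, hα, Pi.sub_apply, Function.comp_apply]
    field_simp
  have hfc : ContinuousOn f (Set.Ioi 0) := fun t ht => (hf t ht).continuousAt.continuousWithinAt
  have hf₁c : ContinuousOn f₁ (Set.Ioi 0) :=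
    fun t ht => (hf₁ t ht).continuousAt.continuousWithinAt
  have hαc : ContinuousOn α (Set.Ioi 0) := fun t ht => (hαd t ht).continuousAt.continuousWithinAt
  have hcc : ContinuousOn c (Set.Ioi 0) :=
    continuousOn_const.sub (continuousOn_const.mul (hfc.mul (hBc.comp_continuousOn hfc)))
  have hα'c : ContinuousOn α' (Set.Ioi 0) :=
    ((hcc.mul hαc).mul hf₁c).div hfc fun t ht => (hf0 t ht).ne'
  have hαle (t) (ht : 0 < t) : α t ≤ f t ^ (1 + σ) := by
    rw [Real.rpow_def_of_pos (hf0 t ht), hα]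
    have : 0 ≤ B (f t) := intervalIntegral.integral_nonneg (hf0 t ht).le
      fun r _ => (inv_pos.2 (hmax0 r)).le
    refine Real.exp_le_exp.2 ?_
    nlinarith
  have hquot (t) (ht : 0 < t) : 0 ≤ f t * (max (f t) κ)⁻¹ ∧ f t * (max (f t) κ)⁻¹ ≤ 1 := by
    refine ⟨mul_nonneg (hf0 t ht).le (inv_pos.2 (hmax0 _)).le, ?_⟩
    rw [← div_eq_mul_inv, div_le_one (hmax0 _)]
    exact le_max_left _ _
  have hc1 (t) (ht : 0 < t) : 1 ≤ c t := by
    have := hquot t ht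
    simp only [hc]; nlinarith
  have hcσ (t) (ht : 0 < t) : c t ≤ 1 + σ := by
    have := hquot t ht
    simp only [hc]; nlinarith
  have hcε (t) (ht : ε ≤ t) : c t = 1 := by
    have h1 : κ ≤ f t := hmono hε (hε.trans_le ht) ht
    have h2 := (hf0 t (hε.trans_le ht)).ne'
    simp only [hc, max_eq_left h1]
    field_simp; ring
  have hα'0 (t) (ht : 0 < t) : 0 ≤ α' t := by
    have := hf0 t ht; have := hf₁0 t ht; have := hα0 t; have := hc1 t ht
    simp only [hα']; positivity
  have hα'le (T) (t) (ht : 0 < t) (htT : t ≤ T) :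
      α' t ^ 2 ≤ ((1 + σ) * f T ^ σ * f₁ T) ^ 2 := by
    have h1 := hf0 t ht; have h2 := hf₁0 t ht; have h3 := hα0 t; have h4 := hc1 t ht
    have h5 := hf0 T (ht.trans_le htT)
    refine pow_le_pow_left₀ (hα'0 t ht) ?_ 2
    calc α' t = c t * α t * f₁ t / f t := rfl
      _ ≤ (1 + σ) * f t ^ (1 + σ) * f₁ t / f t := by
        gcongr
        · exact hcσ t ht
        · exact hαle t ht
      _ = (1 + σ) * f t ^ σ * f₁ t := by
        rw [Real.rpow_add h1, Real.rpow_one]; field_simp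
      _ ≤ _ := by
        gcongr
        · exact hmono ht (ht.trans_le htT) htT
        · exact hmono₁ ht (ht.trans_le htT) htT
  have hint (T) (hT : 0 < T) : IntervalIntegrable (fun s => α' s ^ 2) volume 0 T := by
    rw [intervalIntegrable_iff_integrableOn_Ioc_of_le hT.le]
    refine Integrable.of_bound (((hα'c.pow 2).mono fun s hs => hs.1).aestronglyMeasurable
      measurableSet_Ioc) (((1 + σ) * f T ^ σ * f₁ T) ^ 2) ?_
    refine (ae_restrict_iff' measurableSet_Ioc).2 (ae_of_all _ fun s hs => ?_)
    rw [Real.norm_of_nonneg (sq_nonneg _)]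
    exact hα'le T s hs.1 hs.2
  have hKd (t) (ht : 0 < t) : HasDerivAt K (α' t ^ 2) t :=
    intervalIntegral.integral_hasDerivAt_right (hint t ht)
      ((hα'c.pow 2).stronglyMeasurableAtFilter isOpen_Ioi t ht)
      ((hα'c.pow 2).continuousAt (Ioi_mem_nhds ht))
  have hK0 (t) (ht : 0 < t) : 0 ≤ K t :=
    intervalIntegral.integral_nonneg ht.le fun s _ => sq_nonneg _
  have hKlim : Tendsto K (𝓝[>] 0) (𝓝 0) := by
    refine tendsto_of_tendsto_of_tendsto_of_le_of_le' tendsto_const_nhds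
      (h := fun s => ((1 + σ) * f ε ^ σ * f₁ ε) ^ 2 * s) ?_ ?_ ?_
    · have : Tendsto (fun s : ℝ => ((1 + σ) * f ε ^ σ * f₁ ε) ^ 2 * s) (𝓝 0)
        (𝓝 (((1 + σ) * f ε ^ σ * f₁ ε) ^ 2 * 0)) := tendsto_id.const_mul _
      rw [mul_zero] at this
      exact this.mono_left nhdsWithin_le_nhds
    · filter_upwards [self_mem_nhdsWithin] with s hs using hK0 s hs
    · filter_upwards [Ioc_mem_nhdsGT hε] with s hs
      have := intervalIntegral.norm_integral_le_of_norm_le_const (a := 0) (b := s)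
        (f := fun s => α' s ^ 2) (C := ((1 + σ) * f ε ^ σ * f₁ ε) ^ 2) fun r hr => by
          rw [Set.uIoc_of_le hs.1.le] at hr
          rw [Real.norm_of_nonneg (sq_nonneg _)]
          exact hα'le ε r hr.1 (hr.2.trans hs.2)
      rw [sub_zero, abs_of_pos hs.1] at this
      exact (Real.le_norm_self _).trans this
  have hVd (t) (ht : 0 < t) : HasDerivAt V (α' t ^ 2 +
      α t ^ 2 / f t ^ 2 * (f t * f₂ t - (1 - c t) ^ 2 * f₁ t ^ 2)) t := by
    have h0 := (hf0 t ht).ne'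
    refine (((hf₁ t ht).mul ((hαd t ht).pow 2)).div (hf t ht) h0).congr_deriv ?_
    simp only [hα', Pi.mul_apply, Pi.pow_apply]
    field_simp
    push_cast
    ring
  have hV0 (t) (ht : 0 < t) : 0 < V t := by
    have := hf0 t ht; have := hf₁0 t ht; have := hα0 t
    simp only [hV]; positivity
  set θ := (ρ - σ ^ 2) / (1 + σ) ^ 2 with hθ
  have hθ0 : 0 < θ := div_pos (by linarith) (by positivity)
  have hnear (t) (ht : 0 < t) (htε : t ≤ ε) : (1 + θ) * K t ≤ V t := by
    have hmonoG : MonotoneOn (fun t => V t - (1 + θ) * K t) (Set.Ioc 0 ε) := by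
      have hd (s) (hs : 0 < s) := (hVd s hs).sub ((hKd s hs).const_mul (1 + θ))
      refine monotoneOn_of_deriv_nonneg (convex_Ioc _ _)
        (fun s hs => (hd s hs.1).continuousAt.continuousWithinAt)
        (fun s hs => (hd s (interior_subset hs).1).differentiableAt.differentiableWithinAt)
        fun s hs => ?_
      obtain ⟨hs, hsε⟩ := interior_subset hs
      refine le_of_le_of_eq ?_ (hd s hs).deriv.symm
      have h1 := hfρ s hs hsε
      have h2 : (1 - c s) ^ 2 ≤ σ ^ 2 := by
        have := hc1 s hs; have := hcσ s hs
        nlinarith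
      have h3 : θ * α' s ^ 2 ≤ α s ^ 2 / f s ^ 2 * ((ρ - σ ^ 2) * f₁ s ^ 2) := by
        have h4 : c s ^ 2 ≤ (1 + σ) ^ 2 :=
          pow_le_pow_left₀ (by linarith [hc1 s hs]) (hcσ s hs) 2
        calc _ = (α s ^ 2 / f s ^ 2 * (θ * f₁ s ^ 2)) * c s ^ 2 := by
              simp only [hα']; ring
          _ ≤ (α s ^ 2 / f s ^ 2 * (θ * f₁ s ^ 2)) * (1 + σ) ^ 2 := by gcongr
          _ = _ := by rw [hθ]; field_simp
      have h5 : α s ^ 2 / f s ^ 2 * ((ρ - σ ^ 2) * f₁ s ^ 2) ≤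
          α s ^ 2 / f s ^ 2 * (f s * f₂ s - (1 - c s) ^ 2 * f₁ s ^ 2) := by
        refine mul_le_mul_of_nonneg_left ?_ (by positivity)
        nlinarith [sq_nonneg (f₁ s)]
      linarith
    have hlim : Tendsto (fun s => V t + (1 + θ) * K s) (𝓝[>] 0) (𝓝 (V t + (1 + θ) * 0)) :=
      (hKlim.const_mul _).const_add _
    rw [mul_zero, add_zero] at hlim
    refine ge_of_tendsto hlim ?_
    filter_upwards [Ioc_mem_nhdsGT ht] with s hs
    have := hmonoG ⟨hs.1, hs.2.trans htε⟩ ⟨ht, htε⟩ hs.2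
    have := hV0 s hs.1
    simp only at *
    linarith
  have hfar (t) (ht : ε ≤ t) : V ε - K ε ≤ V t - K t := by
    have hd (s) (hs : 0 < s) := (hVd s hs).sub (hKd s hs)
    have hmonoG : MonotoneOn (fun t => V t - K t) (Set.Ici ε) := by
      refine monotoneOn_of_deriv_nonneg (convex_Ici _)
        (fun s hs => (hd s (hε.trans_le hs)).continuousAt.continuousWithinAt)
        (fun s hs => (hd s (hε.trans_le (interior_subset
          hs))).differentiableAt.differentiableWithinAt) fun s hs => ?_
      replace hs : ε ≤ s := interior_subset hs
      have hs0 := hε.trans_le hs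
      refine le_of_le_of_eq ?_ (hd s hs0).deriv.symm
      have := hf0 s hs0; have := hf₂0 s hs0
      rw [hcε s hs]
      have : 0 ≤ α s ^ 2 / f s ^ 2 * (f s * f₂ s) := by positivity
      linarith
    exact hmonoG Set.self_mem_Ici ht ht
  have hgap : 0 < V ε - K ε := by
    have h1 := hnear ε hε le_rfl
    have h2 := hV0 ε hε
    have h3 := hK0 ε hε
    by_contra! h
    nlinarith
  have hKV (t) (ht : 0 < t) : K t ≤ V t := by
    rcases le_total t ε with h | h
    · have := hnear t ht h
      have := hK0 t ht
      nlinarith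
    · linarith [hfar t h]
  obtain ⟨W, hW⟩ := isCompact_Icc.exists_bound_of_continuousOn (s := Set.Icc ε M) (f := V)
    fun t ht => (hVd t (hε.trans_le ht.1)).continuousAt.continuousWithinAt
  refine ⟨α, α', K, min (θ / (1 + θ)) ((V ε - K ε) / (|W| + 1)), ?_, ?_, hαd, hα'c, hKd, hK0,
    fun t ht => ?_, fun t ht htM => ?_, fun t _ => hα0 t, hαle⟩
  · exact lt_min (by positivity) (by positivity)
  · refine (min_le_left _ _).trans ?_
    rw [div_le_one (by positivity)]; linarith
  · refine (hKV t ht).trans ?_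
    have h1 := hf0 t ht; have := hf₁0 t ht; have := hα0 t
    calc V t = 1 * (α t * (α t * f₁ t / f t)) := by simp only [hV]; ring
      _ ≤ c t * (α t * (α t * f₁ t / f t)) := by gcongr; exact hc1 t ht
      _ = _ := by simp only [hα']; ring
  · have h1 := hf0 t ht
    have hVt := hV0 t ht
    have h2 : f₁ t * α t ^ 2 = f t * V t := by simp only [hV]; field_simp
    rw [h2]
    suffices h : K t ≤ (1 - min (θ / (1 + θ)) ((V ε - K ε) / (|W| + 1))) * V t by
      calc _ ≤ f t * _ := mul_le_mul_of_nonneg_left h h1.le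
        _ = _ := by ring
    rcases le_total t ε with h | h
    · have h3 := hnear t ht h
      have h4 : K t ≤ (1 - θ / (1 + θ)) * V t := by
        have : 1 - θ / (1 + θ) = (1 + θ)⁻¹ := by field_simp; ring
        rw [this, inv_mul_eq_div, le_div_iff₀ (by positivity)]
        linarith
      refine h4.trans (mul_le_mul_of_nonneg_right ?_ hVt.le)
      linarith [min_le_left (θ / (1 + θ)) ((V ε - K ε) / (|W| + 1))]
    · have h3 : V t ≤ |W| + 1 := by
        have h4 := hW t ⟨h, htM⟩
        have h5 := Real.le_norm_self (V t)
        linarith [le_abs_self W]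
      have h4 : (V ε - K ε) / (|W| + 1) * V t ≤ V ε - K ε := by
        rw [div_mul_eq_mul_div, div_le_iff₀ (by positivity)]
        gcongr
      have h5 := hfar t h
      have h6 := mul_le_mul_of_nonneg_right
        (min_le_right (θ / (1 + θ)) ((V ε - K ε) / (|W| + 1))) hVt.le
      linarith

/-- The dimension restriction, expressed through `q₀`. -/
theorem natCast_lt_of_conjugate {N : ℕ} {q₀ p₀ : ℝ≥0∞} (hqfin : q₀ < ⊤)
    (hpq : 1 / p₀ + 1 / q₀ = 1)
    (hdim : N ≤ 9 ∨ (N = 10 ∧ p₀ < ⊤) ∨ (11 ≤ N ∧ p₀ < ENNReal.ofReal (pc N))) :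
    1 ≤ q₀.toReal ∧ (N : ℝ) < 2 + 4 * (q₀.toReal + √q₀.toReal) := by
  rw [one_div, one_div] at hpq
  have hq1' : 1 ≤ q₀ := by
    rw [← ENNReal.inv_le_one, ← hpq]
    exact le_add_self
  lift q₀ to NNReal using hqfin.ne
  have hq1 : (1 : ℝ) ≤ q₀ := by exact_mod_cast hq1'
  rw [ENNReal.coe_toReal]
  refine ⟨hq1, ?_⟩
  set q : ℝ := (q₀ : ℝ) with hq
  have hr1 : 1 ≤ √q := Real.one_le_sqrt.2 hq1
  have hr2 : √q ^ 2 = q := Real.sq_sqrt (by linarith)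
  have hconj (h : p₀ < ⊤) : p₀.toReal⁻¹ + q⁻¹ = 1 := by
    have hp0 : p₀ ≠ 0 := by
      rintro rfl
      simp at hpq
    have := congrArg ENNReal.toReal hpq
    rwa [ENNReal.toReal_add (ENNReal.inv_ne_top.2 hp0)
      (ENNReal.inv_ne_top.2 (one_pos.trans_le hq1').ne'), ENNReal.toReal_inv, ENNReal.toReal_inv,
      ENNReal.coe_toReal, ENNReal.toReal_one] at this
  rcases hdim with h | ⟨rfl, h⟩ | ⟨h, hp⟩
  · have : (N : ℝ) ≤ 9 := by exact_mod_cast h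
    linarith
  · have h1 := hconj h
    have h2 : p₀ ≠ 0 := by
      rintro rfl
      simp at hpq
    have h3 : 0 < p₀.toReal⁻¹ := inv_pos.2 (ENNReal.toReal_pos h2 h.ne)
    have h4 : 1 < q := by
      by_contra! h5
      rw [le_antisymm h5 hq1] at h1
      rw [inv_one] at h1
      linarith
    push_cast
    linarith
  · have hptop : p₀ < ⊤ := hp.trans ENNReal.ofReal_lt_top
    have h1 := hconj hptop
    have hN : (11 : ℝ) ≤ N := by exact_mod_cast h
    have hppc : p₀.toReal < pc N := by
      have := (ENNReal.lt_ofReal_iff_toReal_lt hptop.ne).1 hp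
      exact this
    set s := √((N : ℝ) - 1) with hs
    have hs2 : s ^ 2 = N - 1 := Real.sq_sqrt (by linarith)
    have hs0 : 0 ≤ s := Real.sqrt_nonneg _
    have hs3 : 3 < s := by nlinarith
    by_contra! hcon
    have h2 : 2 * √q ≤ s - 1 := by nlinarith
    have h3 : 4 * q ≤ N - 2 * s := by nlinarith
    have h4 : pc N = (N - 2 * s) / (N - 2 * s - 4) := by
      have : (N : ℝ) = s ^ 2 + 1 := by linarith
      rw [pc, ← hs, this]
      rw [div_eq_div_iff (by nlinarith) (by nlinarith)]
      ring
    have h5 : 0 < (N : ℝ) - 2 * s - 4 := by nlinarith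
    rw [h4, lt_div_iff₀ h5] at hppc
    have hp0 : 0 < p₀.toReal := by
      refine ENNReal.toReal_pos ?_ hptop.ne
      rintro rfl
      simp at hpq
    have h6 : q + p₀.toReal = p₀.toReal * q := by field_simp at h1; linarith
    nlinarith

theorem exists_exponents {N q : ℝ} (hq : 1 ≤ q) (hN : N < 2 + 4 * (q + √q)) :
    ∃ σ ρ b : ℝ, 0 < σ ∧ σ ^ 2 < ρ ∧ ρ < q⁻¹ ∧ q⁻¹ < b ∧ N < 2 + 4 * (1 + σ) / b := by
  set r := √q with hr
  have hr1 : 1 ≤ r := Real.one_le_sqrt.2 hq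
  have hr2 : q = r ^ 2 := (Real.sq_sqrt (by linarith)).symm
  have h1 : ContinuousAt (fun h : ℝ => 2 + 4 * (1 + r⁻¹ * (1 - h)) / (r⁻¹ ^ 2 * (1 + h))) 0 := by
    refine ContinuousAt.add continuousAt_const (ContinuousAt.div (by fun_prop) (by fun_prop) ?_)
    rw [add_zero]; positivity
  have h2 : ∀ᶠ h in 𝓝[>] (0 : ℝ), N < 2 + 4 * (1 + r⁻¹ * (1 - h)) / (r⁻¹ ^ 2 * (1 + h)) := by
    refine (h1.eventually_const_lt ?_).filter_mono nhdsWithin_le_nhds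
    have h3 : 4 * (1 + r⁻¹ * (1 - 0)) / (r⁻¹ ^ 2 * (1 + 0)) = 4 * (r ^ 2 + r) := by
      field_simp
      ring
    beta_reduce
    rwa [h3, ← hr2]
  obtain ⟨h, hN', hh0, hh1⟩ := (h2.and (Ioo_mem_nhdsGT (zero_lt_one' ℝ))).exists
  have hri : 0 < r⁻¹ := by positivity
  have hlt : (r⁻¹ * (1 - h)) ^ 2 < r⁻¹ ^ 2 :=
    pow_lt_pow_left₀ (by nlinarith) (mul_nonneg hri.le (by linarith)) two_ne_zero
  obtain ⟨ρ, hρ1, hρ2⟩ := exists_between hlt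
  refine ⟨r⁻¹ * (1 - h), ρ, r⁻¹ ^ 2 * (1 + h), mul_pos hri (by linarith), hρ1, ?_, ?_, hN'⟩
  · rwa [hr2, ← inv_pow]
  · rw [hr2, ← inv_pow]
    have : 0 < r⁻¹ ^ 2 := by positivity
    nlinarith

theorem exists_mul_rpow_le_deriv {f f₁ f₂ : ℝ → ℝ} {b ε : ℝ} (M : ℝ)
    (hf : ∀ t, 0 < t → HasDerivAt f (f₁ t) t) (hf₁ : ∀ t, 0 < t → HasDerivAt f₁ (f₂ t) t)
    (hf0 : ∀ t, 0 < t → 0 < f t) (hf₁0 : ∀ t, 0 < t → 0 < f₁ t)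
    (hmono : MonotoneOn f (Set.Ioi 0)) (hmono₁ : MonotoneOn f₁ (Set.Ioi 0))
    (hb : 0 < b) (hε : 0 < ε) (hfb : ∀ t, 0 < t → t ≤ ε → f t * f₂ t ≤ b * f₁ t ^ 2) :
    ∃ c, 0 < c ∧ ∀ t, 0 < t → t ≤ M → c * f t ^ b ≤ f₁ t := by
  have hanti : AntitoneOn (fun t => f₁ t * f t ^ (-b)) (Set.Ioc 0 ε) := by
    have hd (s) (hs : 0 < s) := (hf₁ s hs).mul ((hf s hs).rpow_const (p := -b)
      (Or.inl (hf0 s hs).ne'))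
    refine antitoneOn_of_deriv_nonpos (convex_Ioc _ _)
      (fun s hs => (hd s hs.1).continuousAt.continuousWithinAt)
      (fun s hs => (hd s (interior_subset hs).1).differentiableAt.differentiableWithinAt)
      fun s hs => ?_
    obtain ⟨hs, hsε⟩ := interior_subset hs
    refine (hd s hs).deriv.trans_le ?_
    have h0 := hf0 s hs
    have h1 : f s ^ (-b) = f s ^ (-b - 1) * f s := by
      rw [← Real.rpow_add_one h0.ne']; ring_nf
    have h2 : 0 < f s ^ (-b - 1) := by positivity
    rw [h1]
    calc _ = f s ^ (-b - 1) * (f s * f₂ s - b * f₁ s ^ 2) := by ring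
      _ ≤ 0 := mul_nonpos_of_nonneg_of_nonpos h2.le (by linarith [hfb s hs hsε])
  set T := max ε M with hT
  have hT0 : 0 < T := lt_max_of_lt_left hε
  have hε0 := hf0 ε hε
  have hε1 := hf₁0 ε hε
  have hT1 := hf0 T hT0
  refine ⟨f₁ ε * f T ^ (-b), by positivity, fun t ht htM => ?_⟩
  have ht0 := hf0 t ht
  have ht1 := hf₁0 t ht
  rw [Real.rpow_neg hT1.le, ← div_eq_mul_inv, div_mul_eq_mul_div, div_le_iff₀ (by positivity)]
  rcases le_total t ε with h | h
  · have h1 := hanti ⟨ht, h⟩ ⟨hε, le_rfl⟩ h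
    simp only [Real.rpow_neg hε0.le, Real.rpow_neg ht0.le, ← div_eq_mul_inv] at h1
    rw [div_le_div_iff₀ (by positivity) (by positivity)] at h1
    refine h1.trans ?_
    gcongr
    exact hmono hε hT0 (le_max_left _ _)
  · gcongr
    · exact hmono₁ hε ht h
    · exact hmono ht hT0 (htM.trans (le_max_right _ _))

/-- Bounds on `f f'' / f'²` near `0` coming from the limit of `qfun f`. -/
theorem eventually_of_tendsto_qfun {f : ℝ → ℝ} {q₀ : ℝ≥0∞} {ρ b : ℝ} (hqfin : q₀ < ⊤)
    (hq : Tendsto (qfun f) (𝓝[>] (0 : ℝ)) (𝓝 q₀)) (hq1 : 1 ≤ q₀.toReal) (hρ0 : 0 < ρ)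
    (hρ : ρ < q₀.toReal⁻¹) (hb : q₀.toReal⁻¹ < b) (hf0 : ∀ t, 0 < t → 0 < f t)
    (hf₂0 : ∀ t, 0 < t → 0 ≤ deriv (deriv f) t) :
    ∀ᶠ t in 𝓝[>] (0 : ℝ), deriv f t ≠ 0 ∧
      ρ * deriv f t ^ 2 ≤ f t * deriv (deriv f) t ∧
      f t * deriv (deriv f) t ≤ b * deriv f t ^ 2 := by
  have hq0 : 0 < q₀.toReal := by linarith
  have hb0 : 0 < b := (inv_pos.2 hq0).trans hb
  have h1 : ENNReal.ofReal b⁻¹ < q₀ := by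
    rw [ENNReal.ofReal_lt_iff_lt_toReal (by positivity) hqfin.ne]
    exact inv_lt_of_inv_lt₀ hq0 hb
  have h2 : q₀ < ENNReal.ofReal ρ⁻¹ := by
    rw [ENNReal.lt_ofReal_iff_toReal_lt hqfin.ne]
    exact (lt_inv_comm₀ hρ0 hq0).1 hρ
  filter_upwards [hq.eventually_const_lt h1, hq.eventually_lt_const h2, self_mem_nhdsWithin]
    with t ht1 ht2 ht
  have hne : f t * deriv (deriv f) t ≠ 0 := by
    intro h
    rw [qfun, if_pos h] at ht2
    exact not_top_lt ht2
  have hpos : 0 < f t * deriv (deriv f) t :=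
    lt_of_le_of_ne (mul_nonneg (hf0 t ht).le (hf₂0 t ht)) hne.symm
  rw [qfun, if_neg hne] at ht1 ht2
  have h3 := (ENNReal.ofReal_lt_ofReal_iff_of_nonneg (by positivity)).1 ht1
  have h4 := (ENNReal.ofReal_lt_ofReal_iff (by positivity)).1 ht2
  rw [lt_div_iff₀ hpos, inv_mul_eq_div, div_lt_iff₀ hb0] at h3
  rw [div_lt_iff₀ hpos, inv_mul_eq_div, lt_div_iff₀ hρ0] at h4
  refine ⟨fun h => ?_, by linarith, by linarith⟩
  rw [h] at h3
  linarith

/-- Theorem 3.3: nonexistence of bounded positive stable solutions of the differential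
inequality `−Δu ≤ f(u)` in `ℝ^N`, when `q₀ = lim_{u→0⁺} q(u) < ∞`. -/
theorem stmt16 {N : ℕ} (hN : 1 ≤ N) (f : ℝ → ℝ)
    (hC2 : ContDiffOn ℝ 2 f (Set.Ici 0))
    (hconv : ConvexOn ℝ (Set.Ici 0) f) (hmono : MonotoneOn f (Set.Ici 0))
    (hpos : ∀ t : ℝ, 0 < t → 0 < f t)
    (q₀ p₀ : ℝ≥0∞) (hq : Tendsto (qfun f) (𝓝[>] (0:ℝ)) (𝓝 q₀)) (hqfin : q₀ < ⊤)
    (hpq : 1 / p₀ + 1 / q₀ = 1)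
    (hdim : N ≤ 9 ∨ (N = 10 ∧ p₀ < ⊤) ∨ (11 ≤ N ∧ p₀ < ENNReal.ofReal (pc N))) :
    ¬ ∃ u : EuclideanSpace ℝ (Fin N) → ℝ, ContDiff ℝ 2 u ∧
      (∃ M, ∀ x, |u x| ≤ M) ∧ (∀ x, 0 < u x) ∧
      (∀ x, -lap u x ≤ f (u x)) ∧ Stable (deriv f) u := by
  rintro ⟨u, hu, ⟨M, hM⟩, hu0, hineq, hst⟩
  replace hM x : u x ≤ M := (le_abs_self _).trans (hM x)
  obtain ⟨hq1, hNq⟩ := natCast_lt_of_conjugate hqfin hpq hdim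
  obtain ⟨σ, ρ, b, hσ, hσρ, hρq, hqb, hNb⟩ := exists_exponents hq1 hNq
  have hb0 : 0 < b := (inv_pos.2 (by linarith)).trans hqb
  have hC2' : ContDiffOn ℝ (1 + 1) f (Set.Ioi 0) :=
    (hC2.mono Set.Ioi_subset_Ici_self).of_le (by norm_num)
  obtain ⟨hfd, -, hf₁C⟩ := (contDiffOn_succ_iff_deriv_of_isOpen isOpen_Ioi).1 hC2'
  have hf t (ht : 0 < t) : HasDerivAt f (deriv f t) t :=
    (hfd.differentiableAt (Ioi_mem_nhds ht)).hasDerivAt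
  have hf₁ t (ht : 0 < t) : HasDerivAt (deriv f) (deriv (deriv f) t) t :=
    ((hf₁C.differentiableOn (by norm_num)).differentiableAt (Ioi_mem_nhds ht)).hasDerivAt
  have hmono' : MonotoneOn f (Set.Ioi 0) := hmono.mono Set.Ioi_subset_Ici_self
  have hmono₁ : MonotoneOn (deriv f) (Set.Ioi 0) :=
    (hconv.subset Set.Ioi_subset_Ici_self (convex_Ioi 0)).monotoneOn_deriv
      fun t ht => (hf t ht).differentiableAt
  have hf₂0 t (ht : 0 < t) : 0 ≤ deriv (deriv f) t := by
    rw [← derivWithin_of_isOpen isOpen_Ioi ht]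
    exact hmono₁.derivWithin_nonneg
  have hf₁nonneg t (ht : 0 < t) : 0 ≤ deriv f t := by
    rw [← derivWithin_of_isOpen isOpen_Ioi ht]
    exact hmono'.derivWithin_nonneg
  obtain ⟨ε, hε, hev⟩ := mem_nhdsGT_iff_exists_Ioc_subset.1 (eventually_of_tendsto_qfun hqfin hq
    hq1 ((pow_pos hσ 2).trans hσρ) hρq hqb hpos hf₂0)
  replace hε : 0 < ε := hε
  have hf₁0 t (ht : 0 < t) : 0 < deriv f t := by
    have hs : 0 < min t ε := lt_min ht hε
    exact ((hf₁nonneg _ hs).lt_of_ne' (hev ⟨hs, min_le_right _ _⟩).1).trans_le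
      (hmono₁ hs ht (min_le_left _ _))
  obtain ⟨α, α', K, δ, hδ, hδ1, hα, hα'c, hK, hK0, hKα, hfK, hα0, hαle⟩ :=
    exists_weights M hf hf₁ hpos hf₁0 hf₂0 hmono' hmono₁ hσ hσρ hε
      fun t ht htε => (hev ⟨ht, htε⟩).2.1
  obtain ⟨c, hc, hcf⟩ := exists_mul_rpow_le_deriv M hf hf₁ hpos hf₁0 hmono' hmono₁ hb0 hε
    fun t ht htε => (hev ⟨ht, htε⟩).2.2
  obtain ⟨C, hC, hbound⟩ := hst.exists_integral_le hu hu0 hM hineq hfd.continuousOn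
    hf₁C.continuousOn hα hα'c hK hK0 (fun t ht _ => hKα t ht) hδ hδ1 hfK
  have hfu : Continuous fun x => f (u x) := hfd.continuousOn.comp_continuous hu.continuous hu0
  have hf₁u : Continuous fun x => deriv f (u x) :=
    hf₁C.continuousOn.comp_continuous hu.continuous hu0
  have hαu : Continuous fun x => α (u x) :=
    (contDiff_one_comp_of_pos (hu.of_le (by norm_num)) hu0 hα hα'c).continuous
  refine false_of_integral_le (A := fun x => α (u x) ^ 2) (a := 1 + σ) (b := b) (C := C / c) hfu (hαu.pow 2)
    (fun x => hpos _ (hu0 x)) (fun x => pow_pos (hα0 _ (hu0 x)) 2) (fun x => ?_) (by linarith)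
    hb0 (by positivity) hNb fun ψ hψ hψc => ?_
  · have h1 := hpos _ (hu0 x)
    have h2 := hα0 _ (hu0 x)
    rw [mul_comm, Real.rpow_mul h1.le, Real.rpow_two]
    exact pow_le_pow_left₀ h2.le (hαle _ (hu0 x)) 2
  · have hψ2c : HasCompactSupport fun x => ψ x ^ 2 :=
      hψc.comp_left (g := fun t : ℝ => t ^ 2) (by simp)
    rw [div_mul_eq_mul_div, le_div_iff₀ hc, mul_comm, ← integral_const_mul]
    refine le_trans (integral_mono ?_ ?_ fun x => ?_) (hbound ψ hψ hψc)
    · exact (((((hfu.rpow_const fun x => Or.inl (hpos _ (hu0 x)).ne').mul (hαu.pow 2)).mul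
        (hψ.continuous.pow 2)).integrable_of_hasCompactSupport hψ2c.mul_left).const_mul c)
    · exact ((hf₁u.mul (hαu.pow 2)).mul (hψ.continuous.pow 2)).integrable_of_hasCompactSupport
        hψ2c.mul_left
    · calc _ = (c * f (u x) ^ b) * (α (u x) ^ 2 * ψ x ^ 2) := by ring
        _ ≤ deriv f (u x) * (α (u x) ^ 2 * ψ x ^ 2) :=
          mul_le_mul_of_nonneg_right (hcf _ (hu0 x) (hM x)) (by positivity)
        _ = _ := by ring
end

section
/- Let Ω be an open set in ℝ^N, f ∈ C¹, and let u ∈ C²(Ω), u ≥ 0, satisfy −Δu ≤ f(u) in Ω together with the stability inequality ∫_Ω f'(u)φ² dx ≤ ∫_Ω |∇φ|² dx for all φ ∈ C¹_c(Ω). Let ϕ ∈ W^{1,∞}_loc(ℝ;ℝ) (not necessarily convex), ψ(t) = ∫₀^t ϕ'(s)² ds, K(t) = ∫₀^t ψ(s) ds, and η ∈ C²_c(Ω). Then ∫_Ω (f'(u)ϕ(u)² − f(u)ψ(u)) η² dx ≤ ∫_Ω K(u) Δ(η²) dx − ∫_Ω ϕ(u)² η Δη dx. -/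
open MeasureTheory Filter Topology
open scoped ENNReal

section Calculus

variable {E : Type*} [NormedAddCommGroup E] [NormedSpace ℝ E]

lemma ContDiff.hasFDerivAt_fderiv_apply {w : E → ℝ} (hw : ContDiff ℝ 2 w) (e x : E) :
    HasFDerivAt (fun y => fderiv ℝ w y e) (fderiv ℝ (fun y => fderiv ℝ w y e) x) x := by
  have h : ContDiff ℝ 1 (fun y => fderiv ℝ w y e) :=
    (hw.fderiv_right (m := 1) (by norm_num)).clm_apply contDiff_const
  exact (h.differentiable (by norm_num) x).hasFDerivAt

lemma ContDiff.continuous_fderiv_fderiv_apply {w : E → ℝ} (hw : ContDiff ℝ 2 w) (e : E) :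
    Continuous fun x => fderiv ℝ (fun y => fderiv ℝ w y e) x e := by
  have h : ContDiff ℝ 1 (fun y => fderiv ℝ w y e) :=
    (hw.fderiv_right (m := 1) (by norm_num)).clm_apply contDiff_const
  exact (h.continuous_fderiv (by norm_num)).clm_apply continuous_const

lemma fderiv_sq_apply {w : E → ℝ} {y : E} (hw : DifferentiableAt ℝ w y) (e : E) :
    fderiv ℝ (fun z => w z ^ 2) y e = 2 * w y * fderiv ℝ w y e := by
  rw [(hw.hasFDerivAt.pow 2).fderiv]
  simp

lemma fderiv_fderiv_sq_apply {w : E → ℝ} (hw : ContDiff ℝ 2 w) (e x : E) :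
    fderiv ℝ (fun y => fderiv ℝ (fun z => w z ^ 2) y e) x e =
      2 * fderiv ℝ w x e ^ 2 + 2 * w x * fderiv ℝ (fun y => fderiv ℝ w y e) x e := by
  have hd := hw.differentiable (by norm_num)
  rw [funext fun y => fderiv_sq_apply (hd y) e,
    (((hd x).hasFDerivAt.const_mul 2).fun_mul (hw.hasFDerivAt_fderiv_apply e x)).fderiv]
  simp
  ring

lemma integral_fderiv_apply_eq_zero [FiniteDimensional ℝ E] [MeasurableSpace E] [BorelSpace E]
    {μ : Measure E} [μ.IsAddHaarMeasure] {h : E → ℝ} {e : E} (hd : Differentiable ℝ h)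
    (hc : HasCompactSupport h) (hcont : Continuous fun x => fderiv ℝ h x e) :
    ∫ x, fderiv ℝ h x e ∂μ = 0 := by
  have := integral_mul_fderiv_eq_neg_fderiv_mul_of_integrable (μ := μ) (f := fun _ : E => (1 : ℝ))
    (g := h) (v := e) (by simp)
    (by simpa using hcont.integrable_of_hasCompactSupport (hc.fderiv_apply ℝ e))
    (by simpa using hd.continuous.integrable_of_hasCompactSupport hc)
    (fun _ _ => differentiableAt_const _) (fun x _ => hd x)
  simpa using this

/-- One coordinate of the divergence identity behind `integral_norm_gradient_sq`. -/
lemma integral_fderiv_sq_add_eq_zero [FiniteDimensional ℝ E] [MeasurableSpace E] [BorelSpace E]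
    {μ : Measure E} [μ.IsAddHaarMeasure] {v η : E → ℝ} (hv : ContDiff ℝ 2 v)
    (hη : ContDiff ℝ 2 η) (hηc : HasCompactSupport η) {p g S K : ℝ → ℝ}
    (hg : Continuous g) (hp : ∀ t, HasDerivAt p (g t) t) (hS : ∀ t, HasDerivAt S (g t ^ 2) t)
    (hK : ∀ t, HasDerivAt K (S t) t) (e : E) :
    ∫ x, (fderiv ℝ (fun y => p (v y) * η y) x e ^ 2
      + S (v x) * fderiv ℝ (fun y => fderiv ℝ v y e) x e * η x ^ 2
      - K (v x) * fderiv ℝ (fun y => fderiv ℝ (fun z => η z ^ 2) y e) x e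
      + p (v x) ^ 2 * η x * fderiv ℝ (fun y => fderiv ℝ η y e) x e) ∂μ = 0 := by
  set X : E → ℝ := fun y => (S (v y) * fderiv ℝ v y e) * η y ^ 2
    - K (v y) * (2 * η y * fderiv ℝ η y e) + p (v y) ^ 2 * (η y * fderiv ℝ η y e) with hX
  have hvd := hv.differentiable (by norm_num)
  have hηd := hη.differentiable (by norm_num)
  have hXd (x : E) : HasFDerivAt X _ x :=
    (((((hS (v x)).comp_hasFDerivAt x (hvd x).hasFDerivAt).mul
      (hv.hasFDerivAt_fderiv_apply e x)).mul ((hηd x).hasFDerivAt.pow 2)).sub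
      (((hK (v x)).comp_hasFDerivAt x (hvd x).hasFDerivAt).mul
        (((hηd x).hasFDerivAt.const_mul 2).mul (hη.hasFDerivAt_fderiv_apply e x)))).add
      ((((hp (v x)).comp_hasFDerivAt x (hvd x).hasFDerivAt).pow 2).mul
        ((hηd x).hasFDerivAt.mul (hη.hasFDerivAt_fderiv_apply e x)))
  have hφ (x : E) : fderiv ℝ (fun y => p (v y) * η y) x e =
      g (v x) * fderiv ℝ v x e * η x + p (v x) * fderiv ℝ η x e := by
    have h : HasFDerivAt (fun y => p (v y) * η y) _ x :=
      ((hp (v x)).comp_hasFDerivAt x (hvd x).hasFDerivAt).mul (hηd x).hasFDerivAt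
    rw [h.fderiv]
    simp
    ring
  have key (x : E) : fderiv ℝ X x e = fderiv ℝ (fun y => p (v y) * η y) x e ^ 2
      + S (v x) * fderiv ℝ (fun y => fderiv ℝ v y e) x e * η x ^ 2
      - K (v x) * fderiv ℝ (fun y => fderiv ℝ (fun z => η z ^ 2) y e) x e
      + p (v x) ^ 2 * η x * fderiv ℝ (fun y => fderiv ℝ η y e) x e := by
    rw [hφ, fderiv_fderiv_sq_apply hη, (hXd x).fderiv]
    simp
    ring
  have hpc : Continuous p := continuous_iff_continuousAt.2 fun t => (hp t).continuousAt
  have hSc : Continuous S := continuous_iff_continuousAt.2 fun t => (hS t).continuousAt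
  have hKc : Continuous K := continuous_iff_continuousAt.2 fun t => (hK t).continuousAt
  have hv1 : Continuous fun x => fderiv ℝ v x e :=
    (hv.continuous_fderiv (by norm_num)).clm_apply continuous_const
  have hη1 : Continuous fun x => fderiv ℝ η x e :=
    (hη.continuous_fderiv (by norm_num)).clm_apply continuous_const
  have hv2 := hv.continuous_fderiv_fderiv_apply e
  have hη2 := hη.continuous_fderiv_fderiv_apply e
  have hvc := hv.continuous
  have hηcont := hη.continuous
  simp_rw [← key]
  refine integral_fderiv_apply_eq_zero (fun x => (hXd x).differentiableAt) ?_ ?_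
  · refine hηc.mono fun x hx => ?_
    contrapose! hx
    simp only [Function.mem_support, not_not] at hx
    simp [hX, hx]
  · simp_rw [key, hφ, fderiv_fderiv_sq_apply hη]
    fun_prop

end Calculus

section Laplacian

variable {N : ℕ}

lemma lap_eq_sum_fderiv {w : EuclideanSpace ℝ (Fin N) → ℝ} (hw : ContDiff ℝ 2 w)
    (x : EuclideanSpace ℝ (Fin N)) :
    lap w x = ∑ i, fderiv ℝ (fun y => fderiv ℝ w y (EuclideanSpace.single i 1)) x
      (EuclideanSpace.single i 1) := by
  have hd : DifferentiableAt ℝ (fderiv ℝ w) x :=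
    (hw.fderiv_right (m := 1) (by norm_num)).differentiable (by norm_num) x
  simp [lap, iteratedFDeriv_two_apply, fderiv_clm_apply hd (differentiableAt_const _)]

lemma continuous_lap {w : EuclideanSpace ℝ (Fin N) → ℝ} (hw : ContDiff ℝ 2 w) :
    Continuous (lap w) := by
  rw [funext (lap_eq_sum_fderiv hw)]
  exact continuous_finsetSum _ fun i _ => hw.continuous_fderiv_fderiv_apply _

lemma lap_eq_zero_of_notMem_tsupport {w : EuclideanSpace ℝ (Fin N) → ℝ}
    {x : EuclideanSpace ℝ (Fin N)} (hx : x ∉ tsupport w) : lap w x = 0 := by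
  have h : iteratedFDeriv ℝ 2 w x = 0 :=
    image_eq_zero_of_notMem_tsupport fun h => hx (tsupport_iteratedFDeriv_subset 2 h)
  simp [lap, h]

lemma Filter.EventuallyEq.lap_eq {w₁ w₂ : EuclideanSpace ℝ (Fin N) → ℝ}
    {x : EuclideanSpace ℝ (Fin N)} (h : w₁ =ᶠ[𝓝 x] w₂) : lap w₁ x = lap w₂ x := by
  simp [lap, (Filter.EventuallyEq.iteratedFDeriv ℝ h 2).eq_of_nhds]

lemma norm_gradient_sq_eq_sum (w : EuclideanSpace ℝ (Fin N) → ℝ)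
    (x : EuclideanSpace ℝ (Fin N)) :
    ‖gradient w x‖ ^ 2 = ∑ i, fderiv ℝ w x (EuclideanSpace.single i 1) ^ 2 := by
  rw [gradient, LinearIsometryEquiv.norm_map, (EuclideanSpace.basisFun (Fin N) ℝ).norm_dual]
  simp

lemma tsupport_sq_subset {X : Type*} [TopologicalSpace X] (w : X → ℝ) :
    tsupport (fun y => w y ^ 2) ⊆ tsupport w :=
  closure_mono fun x hx => by simpa using hx

lemma integral_norm_gradient_sq {v η : EuclideanSpace ℝ (Fin N) → ℝ} (hv : ContDiff ℝ 2 v)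
    (hη : ContDiff ℝ 2 η) (hηc : HasCompactSupport η) {p g S K : ℝ → ℝ}
    (hg : Continuous g) (hp : ∀ t, HasDerivAt p (g t) t) (hS : ∀ t, HasDerivAt S (g t ^ 2) t)
    (hK : ∀ t, HasDerivAt K (S t) t) :
    ∫ x, ‖gradient (fun y => p (v y) * η y) x‖ ^ 2 =
      (∫ x, K (v x) * lap (fun y => η y ^ 2) x) - (∫ x, S (v x) * (lap v x * η x ^ 2))
        - ∫ x, p (v x) ^ 2 * (η x * lap η x) := by
  have hvc := hv.continuous
  have hηcont := hη.continuous
  have hpc : Continuous p := continuous_iff_continuousAt.2 fun t => (hp t).continuousAt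
  have hSc : Continuous S := continuous_iff_continuousAt.2 fun t => (hS t).continuousAt
  have hKc : Continuous K := continuous_iff_continuousAt.2 fun t => (hK t).continuousAt
  have hφ : ContDiff ℝ 1 (fun y => p (v y) * η y) := by
    have hp1 : ContDiff ℝ 1 p := contDiff_one_iff_deriv.2
      ⟨fun t => (hp t).differentiableAt, by rwa [funext fun t => (hp t).deriv]⟩
    exact (hp1.comp (hv.of_le (by norm_num))).mul (hη.of_le (by norm_num))
  have hη2 : ContDiff ℝ 2 (fun y => η y ^ 2) := hη.pow 2
  have hinteg {F : EuclideanSpace ℝ (Fin N) → ℝ} (hF : Continuous F)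
      (hF0 : ∀ x ∉ tsupport η, F x = 0) : Integrable F :=
    hF.integrable_of_hasCompactSupport (.intro hηc hF0)
  have hη0 (x) (hx : x ∉ tsupport η) : η x = 0 := image_eq_zero_of_notMem_tsupport hx
  have iK : Integrable fun x => K (v x) * lap (fun y => η y ^ 2) x :=
    hinteg ((hKc.comp hvc).mul (continuous_lap hη2)) fun x hx => by
      rw [lap_eq_zero_of_notMem_tsupport fun h => hx (tsupport_sq_subset η h), mul_zero]
  have iS : Integrable fun x => S (v x) * (lap v x * η x ^ 2) :=
    hinteg ((hSc.comp hvc).mul ((continuous_lap hv).mul (by fun_prop))) fun x hx => by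
      simp [hη0 x hx]
  have ip : Integrable fun x => p (v x) ^ 2 * (η x * lap η x) :=
    hinteg (((hpc.comp hvc).pow 2).mul (hηcont.mul (continuous_lap hη))) fun x hx => by
      simp [hη0 x hx]
  have hφs : tsupport (fun y => p (v y) * η y) ⊆ tsupport η := tsupport_mul_subset_right
  have iD (i : Fin N) : Integrable fun x =>
      fderiv ℝ (fun y => p (v y) * η y) x (EuclideanSpace.single i 1) ^ 2 :=
    hinteg (((hφ.continuous_fderiv (by norm_num)).clm_apply continuous_const).pow 2) fun x hx => by
      simp [fderiv_of_notMem_tsupport ℝ fun h => hx (hφs h)]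
  have iKS : Integrable fun x =>
      K (v x) * lap (fun y => η y ^ 2) x - S (v x) * (lap v x * η x ^ 2) := iK.sub iS
  rw [← integral_sub iK iS, ← integral_sub iKS ip, ← sub_eq_zero, ← integral_sub]
  · have hsum := Finset.sum_eq_zero (s := Finset.univ) fun (i : Fin N) _ =>
      integral_fderiv_sq_add_eq_zero (μ := volume) hv hη hηc hg hp hS hK
        (EuclideanSpace.single i 1)
    rw [← integral_finsetSum] at hsum
    · rw [← hsum]
      refine integral_congr_ae (.of_forall fun x => ?_)
      simp only [norm_gradient_sq_eq_sum, lap_eq_sum_fderiv hv, lap_eq_sum_fderiv hη,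
        lap_eq_sum_fderiv hη2, Finset.sum_add_distrib, Finset.sum_sub_distrib, Finset.mul_sum,
        Finset.sum_mul]
      simp only [mul_assoc]
      ring
    · intro i _
      refine (((iD i).add (hinteg ?_ ?_)).sub (hinteg ?_ ?_)).add (hinteg ?_ ?_)
      · exact ((hSc.comp hvc).mul (hv.continuous_fderiv_fderiv_apply _)).mul (hηcont.pow 2)
      · exact fun x hx => by simp [hη0 x hx]
      · exact (hKc.comp hvc).mul (hη2.continuous_fderiv_fderiv_apply _)
      · exact fun x hx => by
          rw [fderiv_fderiv_sq_apply hη, fderiv_of_notMem_tsupport ℝ hx, hη0 x hx]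
          simp
      · exact (((hpc.comp hvc).pow 2).mul hηcont).mul (hη.continuous_fderiv_fderiv_apply _)
      · exact fun x hx => by simp [hη0 x hx]
  · simp_rw [norm_gradient_sq_eq_sum]
    exact integrable_finsetSum _ fun i _ => iD i
  · exact iKS.sub ip

lemma integral_le_of_stable {v η : EuclideanSpace ℝ (Fin N) → ℝ} (hv : ContDiff ℝ 2 v)
    (hv0 : ∀ x, 0 ≤ v x) (hη : ContDiff ℝ 2 η) (hηc : HasCompactSupport η) {f : ℝ → ℝ}
    (hf : ContDiff ℝ 1 f) (hineq : ∀ x ∈ tsupport η, -lap v x ≤ f (v x))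
    (hstab : ∀ φ : EuclideanSpace ℝ (Fin N) → ℝ, ContDiff ℝ 1 φ → tsupport φ ⊆ tsupport η →
      ∫ x, deriv f (v x) * φ x ^ 2 ≤ ∫ x, ‖gradient φ x‖ ^ 2)
    {p g S K : ℝ → ℝ} (hg : Continuous g) (hp : ∀ t, HasDerivAt p (g t) t)
    (hS : ∀ t, HasDerivAt S (g t ^ 2) t) (hS0 : ∀ t, 0 ≤ t → 0 ≤ S t)
    (hK : ∀ t, HasDerivAt K (S t) t) :
    (∫ x, p (v x) ^ 2 * (deriv f (v x) * η x ^ 2)) - (∫ x, S (v x) * (f (v x) * η x ^ 2)) ≤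
      (∫ x, K (v x) * lap (fun y => η y ^ 2) x) - ∫ x, p (v x) ^ 2 * (η x * lap η x) := by
  have hvc := hv.continuous
  have hηcont := hη.continuous
  have hfc := hf.continuous
  have hpc : Continuous p := continuous_iff_continuousAt.2 fun t => (hp t).continuousAt
  have hSc : Continuous S := continuous_iff_continuousAt.2 fun t => (hS t).continuousAt
  have hp1 : ContDiff ℝ 1 p := contDiff_one_iff_deriv.2
    ⟨fun t => (hp t).differentiableAt, by rwa [funext fun t => (hp t).deriv]⟩
  have hst := hstab (fun y => p (v y) * η y)
    ((hp1.comp (hv.of_le (by norm_num))).mul (hη.of_le (by norm_num))) tsupport_mul_subset_right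
  rw [integral_norm_gradient_sq hv hη hηc hg hp hS hK] at hst
  have hη0 (x) (hx : x ∉ tsupport η) : η x = 0 := image_eq_zero_of_notMem_tsupport hx
  have hle : -∫ x, S (v x) * (lap v x * η x ^ 2) ≤ ∫ x, S (v x) * (f (v x) * η x ^ 2) := by
    rw [← integral_neg]
    refine integral_mono ?_ ?_ fun x => ?_
    · exact ((hSc.comp hvc).mul ((continuous_lap hv).mul (hηcont.pow 2))).neg
        |>.integrable_of_hasCompactSupport (.intro hηc fun x hx => by simp [hη0 x hx])
    · exact ((hSc.comp hvc).mul ((hfc.comp hvc).mul (hηcont.pow 2)))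
        |>.integrable_of_hasCompactSupport (.intro hηc fun x hx => by simp [hη0 x hx])
    · by_cases hx : x ∈ tsupport η
      · have := mul_le_mul_of_nonneg_left
          (mul_le_mul_of_nonneg_right (hineq x hx) (sq_nonneg (η x))) (hS0 _ (hv0 x))
        simp only
        linarith
      · simp [hη0 x hx]
  have heq : ∫ x, p (v x) ^ 2 * (deriv f (v x) * η x ^ 2) =
      ∫ x, deriv f (v x) * (p (v x) * η x) ^ 2 :=
    integral_congr_ae (.of_forall fun x => by simp only; ring)
  linarith

end Laplacian

section Limit

lemma intervalIntegral.tendsto_of_norm_le_of_ae_tendsto {g : ℕ → ℝ → ℝ} {h : ℝ → ℝ} {C M t : ℝ}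
    (hg : ∀ n, Continuous (g n)) (hC : ∀ n, ∀ s ∈ Set.Icc 0 M, |g n s| ≤ C)
    (hlim : ∀ᵐ s, s ∈ Set.Icc 0 M → Tendsto (fun n => g n s) atTop (𝓝 (h s)))
    (ht : t ∈ Set.Icc 0 M) :
    Tendsto (fun n => ∫ s in (0 : ℝ)..t, g n s) atTop (𝓝 (∫ s in (0 : ℝ)..t, h s)) := by
  have hsub : Set.uIoc 0 t ⊆ Set.Icc 0 M := by
    rw [Set.uIoc_of_le ht.1]
    exact fun s hs => ⟨hs.1.le, hs.2.trans ht.2⟩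
  refine intervalIntegral.tendsto_integral_filter_of_dominated_convergence (fun _ => C)
    (.of_forall fun n => (hg n).aestronglyMeasurable)
    (.of_forall fun n => .of_forall fun s hs => hC n s (hsub hs)) (by simp) ?_
  filter_upwards [hlim] with s hs hst using hs (hsub hst)

lemma intervalIntegral.abs_le_of_abs_le {g : ℝ → ℝ} {C M t : ℝ}
    (hC : ∀ s ∈ Set.Icc 0 M, |g s| ≤ C) (ht : t ∈ Set.Icc 0 M) :
    |∫ s in (0 : ℝ)..t, g s| ≤ C * M := by
  have h0 : 0 ≤ C := (abs_nonneg _).trans (hC t ht)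
  have h := intervalIntegral.norm_integral_le_of_norm_le_const (a := 0) (b := t) (f := g) (C := C)
    fun s hs => hC s (by rw [Set.uIoc_of_le ht.1] at hs; exact ⟨hs.1.le, hs.2.trans ht.2⟩)
  rw [Real.norm_eq_abs, sub_zero, abs_of_nonneg ht.1] at h
  exact h.trans (mul_le_mul_of_nonneg_left ht.2 h0)

/-- A locally Lipschitz function on the line has continuous, uniformly bounded approximate
derivatives on compact intervals, given by its difference quotients. -/
lemma LocallyLipschitz.exists_continuous_tendsto_deriv {ϕ : ℝ → ℝ} (hϕ : LocallyLipschitz ϕ)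
    (M : ℝ) : ∃ (g : ℕ → ℝ → ℝ) (C : ℝ), (∀ n, Continuous (g n)) ∧
      (∀ n, ∀ s ∈ Set.Icc 0 M, |g n s| ≤ C) ∧
      ∀ᵐ s, s ∈ Set.Icc 0 M → Tendsto (fun n => g n s) atTop (𝓝 (deriv ϕ s)) := by
  obtain ⟨L, hL⟩ := (hϕ.locallyLipschitzOn (s := Set.Icc (-1) (M + 1)))
    |>.exists_lipschitzOnWith_of_compact isCompact_Icc
  have hcont := hϕ.continuous
  refine ⟨fun n s => ((1 : ℝ) / (n + 1))⁻¹ * (ϕ (s + 1 / (n + 1)) - ϕ s), L,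
    fun n => by fun_prop, fun n s hs => ?_, ?_⟩
  · have hn : (0 : ℝ) < 1 / (n + 1) := by positivity
    have hn1 : (1 : ℝ) / (n + 1) ≤ 1 := by
      rw [div_le_one (by positivity)]
      simp
    have h := hL.dist_le_mul (s + 1 / (n + 1)) ⟨by linarith [hs.1], by linarith [hs.2]⟩ s
      ⟨by linarith [hs.1], by linarith [hs.2]⟩
    rw [Real.dist_eq, Real.dist_eq, add_sub_cancel_left, abs_of_pos hn] at h
    rw [abs_mul, abs_of_pos (inv_pos.2 hn), inv_mul_le_iff₀ hn, mul_comm]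
    exact h
  · filter_upwards [hL.ae_differentiableWithinAt_of_mem_real] with s hs hsM
    have hd : DifferentiableAt ℝ ϕ s :=
      (hs ⟨by linarith [hsM.1], by linarith [hsM.2]⟩).differentiableAt
        (Icc_mem_nhds (by linarith [hsM.1]) (by linarith [hsM.2]))
    have h0 : Tendsto (fun n : ℕ => (1 : ℝ) / (n + 1)) atTop (𝓝[>] 0) :=
      tendsto_nhdsWithin_iff.2 ⟨tendsto_one_div_add_atTop_nhds_zero_nat,
        .of_forall fun n => Set.mem_Ioi.2 (by positivity)⟩
    simpa [Function.comp_def] using hd.hasDerivAt.tendsto_slope_zero_right.comp h0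

lemma LocallyLipschitz.integral_deriv_eq_sub {ϕ : ℝ → ℝ} (hϕ : LocallyLipschitz ϕ) (a b : ℝ) :
    ∫ s in a..b, deriv ϕ s = ϕ b - ϕ a := by
  obtain ⟨L, hL⟩ := (hϕ.locallyLipschitzOn (s := Set.uIcc a b))
    |>.exists_lipschitzOnWith_of_compact isCompact_uIcc
  exact hL.absolutelyContinuousOnInterval.integral_deriv_eq_sub

lemma tendsto_integral_comp_mul {E : Type*} [TopologicalSpace E] [MeasurableSpace E]
    [OpensMeasurableSpace E] {μ : Measure E} [IsFiniteMeasureOnCompacts μ] {v w : E → ℝ} {M C : ℝ}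
    (hv : Continuous v) (hvM : ∀ x, v x ∈ Set.Icc 0 M) (hw : Continuous w)
    (hwc : HasCompactSupport w) {G : ℕ → ℝ → ℝ} {H : ℝ → ℝ} (hG : ∀ n, Continuous (G n))
    (hC : ∀ n, ∀ s ∈ Set.Icc 0 M, |G n s| ≤ C)
    (hlim : ∀ s ∈ Set.Icc 0 M, Tendsto (fun n => G n s) atTop (𝓝 (H s))) :
    Integrable (fun x => H (v x) * w x) μ ∧
      Tendsto (fun n => ∫ x, G n (v x) * w x ∂μ) atTop (𝓝 (∫ x, H (v x) * w x ∂μ)) := by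
  have hb : Integrable (fun x => C * |w x|) μ :=
    ((hw.integrable_of_hasCompactSupport hwc).abs).const_mul C
  have hm (n : ℕ) : AEStronglyMeasurable (fun x => G n (v x) * w x) μ := by
    have := hw.integrable_of_hasCompactSupport (μ := μ) hwc
    exact ((hG n).comp hv).measurable.aestronglyMeasurable.mul this.aestronglyMeasurable
  have hle (n : ℕ) (x : E) : ‖G n (v x) * w x‖ ≤ C * |w x| := by
    rw [norm_mul]
    exact mul_le_mul_of_nonneg_right (hC n _ (hvM x)) (abs_nonneg _)
  have ht (x : E) : Tendsto (fun n => G n (v x) * w x) atTop (𝓝 (H (v x) * w x)) :=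
    (hlim _ (hvM x)).mul_const _
  refine ⟨hb.mono' (aestronglyMeasurable_of_tendsto_ae atTop hm (.of_forall ht))
    (.of_forall fun x => le_of_tendsto (ht x).norm (.of_forall fun n => hle n x)), ?_⟩
  exact tendsto_integral_of_dominated_convergence _ hm hb (fun n => .of_forall (hle n))
    (.of_forall ht)

end Limit

open scoped Manifold in
/-- A nonnegative `C²` function on an open set agrees near a compact subset with a globally
defined, nonnegative, bounded `C²` function. -/
lemma exists_contDiff_eq_nhds_of_isCompact {E : Type*} [NormedAddCommGroup E] [NormedSpace ℝ E]
    [FiniteDimensional ℝ E] {Ω A : Set E} (hΩ : IsOpen Ω) {u : E → ℝ} (hu : ContDiffOn ℝ 2 u Ω)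
    (hnonneg : ∀ x ∈ Ω, 0 ≤ u x) (hA : IsCompact A) (hAΩ : A ⊆ Ω) :
    ∃ (v : E → ℝ) (M : ℝ), ContDiff ℝ 2 v ∧ (∀ x, v x ∈ Set.Icc 0 M) ∧
      ∀ x ∈ A, v =ᶠ[𝓝 x] u := by
  obtain ⟨T, hT, hAT, hTΩ⟩ := exists_compact_between hA hΩ hAΩ
  obtain ⟨χ, hχ1, hχ0, hχ⟩ := exists_contMDiffMap_one_nhds_of_subset_interior (n := 2) 𝓘(ℝ, E)
    hA.isClosed hAT
  have hχd : ContDiff ℝ 2 χ := χ.contMDiff.contDiff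
  have hv : ContDiff ℝ 2 fun x => χ x * u x := by
    refine contDiff_iff_contDiffAt.2 fun x => ?_
    by_cases hx : x ∈ Ω
    · exact hχd.contDiffAt.mul (hu.contDiffAt (hΩ.mem_nhds hx))
    · refine (contDiffAt_const (c := (0 : ℝ))).congr_of_eventuallyEq ?_
      filter_upwards [hT.isClosed.isOpen_compl.mem_nhds fun h => hx (hTΩ h)] with y hy
      simp [hχ0 y hy]
  obtain ⟨M, hM⟩ := (HasCompactSupport.intro hT fun x hx => by simp [hχ0 x hx] :
    HasCompactSupport fun x => χ x * u x).exists_bound_of_continuous hv.continuous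
  refine ⟨_, M, hv, fun x => ⟨?_, (le_abs_self _).trans (hM x)⟩, fun x hx => ?_⟩
  · by_cases hx : x ∈ Ω
    · exact mul_nonneg (hχ x).1 (hnonneg x hx)
    · simp [hχ0 x fun h => hx (hTΩ h)]
  · filter_upwards [eventually_nhdsSet_iff_forall.1 hχ1 x hx] with y hy
    simp [hy]

lemma integral_le_of_stable_of_locallyLipschitz {N : ℕ} {v η : EuclideanSpace ℝ (Fin N) → ℝ}
    (hv : ContDiff ℝ 2 v) {M : ℝ} (hvM : ∀ x, v x ∈ Set.Icc 0 M) (hη : ContDiff ℝ 2 η)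
    (hηc : HasCompactSupport η) {f : ℝ → ℝ} (hf : ContDiff ℝ 1 f)
    (hineq : ∀ x ∈ tsupport η, -lap v x ≤ f (v x))
    (hstab : ∀ φ : EuclideanSpace ℝ (Fin N) → ℝ, ContDiff ℝ 1 φ → tsupport φ ⊆ tsupport η →
      ∫ x, deriv f (v x) * φ x ^ 2 ≤ ∫ x, ‖gradient φ x‖ ^ 2)
    {ϕ : ℝ → ℝ} (hϕ : LocallyLipschitz ϕ) :
    ∫ x, (ϕ (v x) ^ 2 * (deriv f (v x) * η x ^ 2) -
        (∫ s in (0 : ℝ)..(v x), deriv ϕ s ^ 2) * (f (v x) * η x ^ 2)) ≤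
      (∫ x, (∫ s in (0 : ℝ)..(v x), ∫ r in (0 : ℝ)..s, deriv ϕ r ^ 2) *
        lap (fun y => η y ^ 2) x) - ∫ x, ϕ (v x) ^ 2 * (η x * lap η x) := by
  obtain ⟨g, C, hg, hgC, hglim⟩ := hϕ.exists_continuous_tendsto_deriv M
  set p : ℕ → ℝ → ℝ := fun n t => ϕ 0 + ∫ s in (0 : ℝ)..t, g n s
  set S : ℕ → ℝ → ℝ := fun n t => ∫ s in (0 : ℝ)..t, g n s ^ 2
  set K : ℕ → ℝ → ℝ := fun n t => ∫ s in (0 : ℝ)..t, S n s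
  have hp (n t) : HasDerivAt (p n) (g n t) t := ((hg n).integral_hasStrictDerivAt 0 t).hasDerivAt
      |>.const_add _
  have hS (n t) : HasDerivAt (S n) (g n t ^ 2) t :=
    (((hg n).pow 2).integral_hasStrictDerivAt 0 t).hasDerivAt
  have hSc (n) : Continuous (S n) := continuous_iff_continuousAt.2 fun t => (hS n t).continuousAt
  have hpc (n) : Continuous (p n) := continuous_iff_continuousAt.2 fun t => (hp n t).continuousAt
  have hK (n t) : HasDerivAt (K n) (S n t) t := ((hSc n).integral_hasStrictDerivAt 0 t).hasDerivAt
  have hKc (n) : Continuous (K n) := continuous_iff_continuousAt.2 fun t => (hK n t).continuousAt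
  have hg2C (n) (s) (hs : s ∈ Set.Icc 0 M) : |g n s ^ 2| ≤ C ^ 2 := by
    rw [abs_pow]
    exact pow_le_pow_left₀ (abs_nonneg _) (hgC n s hs) 2
  have hSb (n t) (ht : t ∈ Set.Icc 0 M) : |S n t| ≤ C ^ 2 * M :=
    intervalIntegral.abs_le_of_abs_le (hg2C n) ht
  have hKb (n t) (ht : t ∈ Set.Icc 0 M) : |K n t| ≤ C ^ 2 * M * M :=
    intervalIntegral.abs_le_of_abs_le (hSb n) ht
  have hpb (n t) (ht : t ∈ Set.Icc 0 M) : |p n t ^ 2| ≤ (|ϕ 0| + C * M) ^ 2 := by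
    rw [abs_pow]
    exact pow_le_pow_left₀ (abs_nonneg _) ((abs_add_le _ _).trans
      (add_le_add_right (intervalIntegral.abs_le_of_abs_le (hgC n) ht) _)) 2
  have hSlim (t) (ht : t ∈ Set.Icc 0 M) :
      Tendsto (fun n => S n t) atTop (𝓝 (∫ s in (0 : ℝ)..t, deriv ϕ s ^ 2)) :=
    intervalIntegral.tendsto_of_norm_le_of_ae_tendsto (fun n => (hg n).pow 2) hg2C
      (by filter_upwards [hglim] with s hs hsM using (hs hsM).pow 2) ht
  have hKlim (t) (ht : t ∈ Set.Icc 0 M) : Tendsto (fun n => K n t) atTop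
      (𝓝 (∫ s in (0 : ℝ)..t, ∫ r in (0 : ℝ)..s, deriv ϕ r ^ 2)) :=
    intervalIntegral.tendsto_of_norm_le_of_ae_tendsto hSc hSb (.of_forall hSlim) ht
  have hplim (t) (ht : t ∈ Set.Icc 0 M) : Tendsto (fun n => p n t ^ 2) atTop (𝓝 (ϕ t ^ 2)) := by
    have h := (intervalIntegral.tendsto_of_norm_le_of_ae_tendsto hg hgC hglim ht).const_add (ϕ 0)
    rw [hϕ.integral_deriv_eq_sub, add_sub_cancel] at h
    exact h.pow 2
  have hvc := hv.continuous
  have hηcont := hη.continuous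
  have hη0 (x) (hx : x ∉ tsupport η) : η x = 0 := image_eq_zero_of_notMem_tsupport hx
  obtain ⟨i₁, l₁⟩ := tendsto_integral_comp_mul (μ := volume) hvc hvM
    (w := fun x => deriv f (v x) * η x ^ 2)
    (((hf.continuous_deriv le_rfl).comp hvc).mul (hηcont.pow 2))
    (.intro hηc fun x hx => by simp [hη0 x hx]) (fun n => (hpc n).pow 2) hpb hplim
  obtain ⟨i₂, l₂⟩ := tendsto_integral_comp_mul (μ := volume) hvc hvM
    (w := fun x => f (v x) * η x ^ 2) ((hf.continuous.comp hvc).mul (hηcont.pow 2))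
    (.intro hηc fun x hx => by simp [hη0 x hx]) hSc hSb hSlim
  obtain ⟨-, l₃⟩ := tendsto_integral_comp_mul (μ := volume) hvc hvM
    (continuous_lap (hη.pow 2)) (.intro hηc fun x hx =>
      lap_eq_zero_of_notMem_tsupport fun h => hx (tsupport_sq_subset η h)) hKc hKb hKlim
  obtain ⟨-, l₄⟩ := tendsto_integral_comp_mul (μ := volume) hvc hvM
    (w := fun x => η x * lap η x) (hηcont.mul (continuous_lap hη))
    (.intro hηc fun x hx => by simp [hη0 x hx]) (fun n => (hpc n).pow 2) hpb hplim
  rw [integral_sub i₁ i₂]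
  exact le_of_tendsto_of_tendsto' (l₁.sub l₂) (l₃.sub l₄) fun n =>
    integral_le_of_stable hv (fun x => (hvM x).1) hη hηc hf hineq hstab (hg n) (hp n) (hS n)
      (fun t ht => intervalIntegral.integral_nonneg ht fun s _ => sq_nonneg _) (hK n)

/-- Remark 3.5 (variant of the weighted Poincaré inequality for non-convex `ϕ`):
with `ψ(t) = ∫₀^t ϕ'(s)² ds`, `K(t) = ∫₀^t ψ(s) ds` and `η ∈ C²_c(Ω)`, one has
`∫_Ω (f'(u)ϕ(u)² − f(u)ψ(u)) η² ≤ ∫_Ω K(u) Δ(η²) − ∫_Ω ϕ(u)² η Δη`. -/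
theorem stmt18 {N : ℕ} (Ω : Set (EuclideanSpace ℝ (Fin N))) (hΩ : IsOpen Ω)
    (f : ℝ → ℝ) (hf : ContDiff ℝ 1 f)
    (u : EuclideanSpace ℝ (Fin N) → ℝ) (hu : ContDiffOn ℝ 2 u Ω)
    (hnonneg : ∀ x ∈ Ω, 0 ≤ u x)
    (hineq : ∀ x ∈ Ω, -lap u x ≤ f (u x))
    (hstab : ∀ φ : EuclideanSpace ℝ (Fin N) → ℝ, ContDiff ℝ 1 φ →
      HasCompactSupport φ → tsupport φ ⊆ Ω →
      ∫ x in Ω, deriv f (u x) * (φ x) ^ 2 ≤ ∫ x in Ω, ‖gradient φ x‖ ^ 2)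
    (ϕ : ℝ → ℝ) (hϕ : LocallyLipschitz ϕ)
    (η : EuclideanSpace ℝ (Fin N) → ℝ) (hη : ContDiff ℝ 2 η)
    (hηc : HasCompactSupport η) (hηΩ : tsupport η ⊆ Ω) :
    ∫ x in Ω, (deriv f (u x) * (ϕ (u x)) ^ 2 -
        f (u x) * ∫ s in (0:ℝ)..(u x), (deriv ϕ s) ^ 2) * (η x) ^ 2
      ≤ (∫ x in Ω, (∫ s in (0:ℝ)..(u x), ∫ r in (0:ℝ)..s, (deriv ϕ r) ^ 2) *
            lap (fun y => (η y) ^ 2) x)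
        - ∫ x in Ω, (ϕ (u x)) ^ 2 * η x * lap η x := by
  obtain ⟨v, M, hv, hvM, hvu⟩ := exists_contDiff_eq_nhds_of_isCompact hΩ hu hnonneg hηc hηΩ
  have hvu' (x) (hx : x ∈ tsupport η) : v x = u x := (hvu x hx).eq_of_nhds
  have hη0 (x) (hx : x ∉ tsupport η) : η x = 0 := image_eq_zero_of_notMem_tsupport hx
  have hset {F G : EuclideanSpace ℝ (Fin N) → ℝ} (hF : ∀ x ∉ tsupport η, F x = 0)
      (hG : ∀ x ∉ tsupport η, G x = 0) (hFG : ∀ x ∈ tsupport η, F x = G x) :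
      ∫ x in Ω, F x = ∫ x, G x := by
    rw [setIntegral_eq_integral_of_forall_compl_eq_zero fun x hx => hF x fun h => hx (hηΩ h)]
    refine integral_congr_ae (.of_forall fun x => ?_)
    by_cases hx : x ∈ tsupport η
    · exact hFG x hx
    · rw [hF x hx, hG x hx]
  have hlapsq (x) (hx : x ∉ tsupport η) : lap (fun y => η y ^ 2) x = 0 :=
    lap_eq_zero_of_notMem_tsupport fun h => hx (tsupport_sq_subset η h)
  rw [hset (G := fun x => ϕ (v x) ^ 2 * (deriv f (v x) * η x ^ 2) -
      (∫ s in (0:ℝ)..(v x), deriv ϕ s ^ 2) * (f (v x) * η x ^ 2))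
      (fun x hx => by simp [hη0 x hx]) (fun x hx => by simp [hη0 x hx])
      (fun x hx => by rw [hvu' x hx]; ring),
    hset (G := fun x => (∫ s in (0:ℝ)..(v x), ∫ r in (0:ℝ)..s, deriv ϕ r ^ 2) *
      lap (fun y => η y ^ 2) x)
      (fun x hx => by simp [hlapsq x hx]) (fun x hx => by simp [hlapsq x hx])
      (fun x hx => by rw [hvu' x hx]),
    hset (G := fun x => ϕ (v x) ^ 2 * (η x * lap η x))
      (fun x hx => by simp [hη0 x hx]) (fun x hx => by simp [hη0 x hx])
      (fun x hx => by rw [hvu' x hx]; ring)]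
  refine integral_le_of_stable_of_locallyLipschitz hv hvM hη hηc hf (fun x hx => ?_)
    (fun φ hφ hφη => ?_) hϕ
  · rw [(hvu x hx).lap_eq, hvu' x hx]
    exact hineq x (hηΩ hx)
  · have h := hstab φ hφ (hηc.of_isClosed_subset (isClosed_tsupport _) hφη) (hφη.trans hηΩ)
    have hφ0 (x) (hx : x ∉ tsupport η) : φ x = 0 :=
      image_eq_zero_of_notMem_tsupport fun h => hx (hφη h)
    have hg0 (x) (hx : x ∉ tsupport η) : ‖gradient φ x‖ ^ 2 = 0 := by
      simp [gradient, fderiv_of_notMem_tsupport ℝ fun h => hx (hφη h)]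
    rwa [hset (G := fun x => deriv f (v x) * φ x ^ 2) (fun x hx => by simp [hφ0 x hx])
      (fun x hx => by simp [hφ0 x hx]) (fun x hx => by rw [hvu' x hx]),
      hset hg0 hg0 fun x _ => rfl] at h
end

section
/- Let f ∈ C⁰([0,∞)) ∩ C²((0,∞)) be nondecreasing and convex with f > 0 on (0,∞), f(0) = 0 and f'(0⁺) = 0, and assume q₀ = lim_{u→0⁺} q(u) exists in [1,+∞], where q(u) = f'(u)²/(f(u)f''(u)) (with q(u) = +∞ when f(u)f''(u) = 0). Then the quantity p(u) = u f'(u)/f(u) satisfies lim_{u→0⁺} p(u) = p₀, where p₀ is the conjugate exponent of q₀, i.e. 1/p₀ + 1/q₀ = 1. -/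
open MeasureTheory Filter Topology
open scoped ENNReal

/-- If `f / f'` tends to `0` at `0⁺` and `f f'' / (f')²` tends to `1 - l`, then
`f / (t f')` tends to `l`. -/
theorem tendsto_div_mul_deriv_of_tendsto {f : ℝ → ℝ} {l : ℝ}
    (hf : ∀ t : ℝ, 0 < t → HasDerivAt f (deriv f t) t)
    (hf' : ∀ t : ℝ, 0 < t → HasDerivAt (deriv f) (deriv (deriv f) t) t)
    (hne : ∀ t : ℝ, 0 < t → deriv f t ≠ 0)
    (h0 : Tendsto (fun t => f t / deriv f t) (𝓝[>] (0:ℝ)) (𝓝 0))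
    (hl : Tendsto (fun t => f t * deriv (deriv f) t / deriv f t ^ 2) (𝓝[>] (0:ℝ))
      (𝓝 (1 - l))) :
    Tendsto (fun t => f t / deriv f t / t) (𝓝[>] (0:ℝ)) (𝓝 l) := by
  have hpos : ∀ᶠ t : ℝ in 𝓝[>] (0:ℝ), 0 < t := self_mem_nhdsWithin
  refine HasDerivAt.lhopital_zero_nhdsGT
    (f' := fun t => 1 - f t * deriv (deriv f) t / deriv f t ^ 2) (g' := fun _ => 1)
    ?_ ?_ ?_ h0 (tendsto_id.mono_left nhdsWithin_le_nhds) ?_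
  · filter_upwards [hpos] with t ht
    have hnt := hne t ht
    have hd := (hf t ht).div (hf' t ht) hnt
    rwa [sub_div, ← sq, div_self (pow_ne_zero 2 hnt)] at hd
  · exact Eventually.of_forall fun t => hasDerivAt_id t
  · exact Eventually.of_forall fun _ => one_ne_zero
  · simpa using (tendsto_const_nhds (x := (1:ℝ))).sub hl

/-- A convex function on `(0, ∞)`, continuous at `0` with `f 0 = 0`, lies below `t f'(t)`. -/
theorem ConvexOn.le_mul_deriv_of_zero {f : ℝ → ℝ}
    (hcont : ContinuousOn f (Set.Ici 0)) (hdiff : ∀ t : ℝ, 0 < t → DifferentiableAt ℝ f t)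
    (hconv : ConvexOn ℝ (Set.Ioi 0) f) (hf0 : f 0 = 0) {t : ℝ} (ht : 0 < t) :
    f t ≤ t * deriv f t := by
  obtain ⟨c, hc, hceq⟩ := exists_deriv_eq_slope f ht (hcont.mono Set.Icc_subset_Ici_self)
    fun x hx => (hdiff x hx.1).differentiableWithinAt
  have hle : deriv f c ≤ deriv f t :=
    hconv.monotoneOn_deriv (fun x hx => hdiff x hx) hc.1 ht hc.2.le
  rw [hceq, hf0, sub_zero, sub_zero, div_le_iff₀ ht] at hle
  linarith

/-- Where `qfun f` is nonzero, its reciprocal is `f f'' / (f')²`. -/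
theorem inv_qfun_toReal {f : ℝ → ℝ} {t : ℝ} (hq : qfun f t ≠ 0) :
    ((qfun f t)⁻¹).toReal = f t * deriv (deriv f) t / deriv f t ^ 2 := by
  unfold qfun at hq ⊢
  split_ifs at hq ⊢ with h
  · simp [h]
  · have hp := ENNReal.ofReal_pos.mp (pos_iff_ne_zero.mpr hq)
    rw [ENNReal.toReal_inv, ENNReal.toReal_ofReal hp.le, inv_div]

/-- Equation (31): if `f(0) = 0`, `f'(0⁺) = 0` and `q₀ = lim_{u→0⁺} q(u)` exists in
`[1,∞]`, then `p(u) = u f'(u)/f(u)` tends to the conjugate exponent `p₀` of `q₀`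
as `u → 0⁺`. -/
theorem stmt19 (f : ℝ → ℝ)
    (hcont : ContinuousOn f (Set.Ici 0)) (hC2 : ContDiffOn ℝ 2 f (Set.Ioi 0))
    (hconv : ConvexOn ℝ (Set.Ioi 0) f) (hmono : MonotoneOn f (Set.Ici 0))
    (hpos : ∀ t : ℝ, 0 < t → 0 < f t) (hf0 : f 0 = 0)
    (hf'0 : Tendsto (deriv f) (𝓝[>] (0:ℝ)) (𝓝 0))
    (q₀ p₀ : ℝ≥0∞) (hq₀1 : 1 ≤ q₀)
    (hq : Tendsto (qfun f) (𝓝[>] (0:ℝ)) (𝓝 q₀))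
    (hpq : 1 / p₀ + 1 / q₀ = 1) :
    Tendsto (fun t : ℝ => ENNReal.ofReal (t * deriv f t / f t)) (𝓝[>] (0:ℝ))
      (𝓝 p₀) := by
  have hdiff : ∀ t : ℝ, 0 < t → DifferentiableAt ℝ f t := fun t ht =>
    (hC2.contDiffAt (Ioi_mem_nhds ht)).differentiableAt (by norm_num)
  have hdiff' : ∀ t : ℝ, 0 < t → DifferentiableAt ℝ (deriv f) t := fun t ht =>
    (((contDiffOn_succ_iff_deriv_of_isOpen (n := 1) isOpen_Ioi).mp hC2).2.2.contDiffAt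
      (Ioi_mem_nhds ht)).differentiableAt (by norm_num)
  have hle : ∀ t : ℝ, 0 < t → f t ≤ t * deriv f t := fun t ht =>
    hconv.le_mul_deriv_of_zero hcont hdiff hf0 ht
  have hder : ∀ t : ℝ, 0 < t → 0 < deriv f t := fun t ht =>
    pos_of_mul_pos_right ((hpos t ht).trans_le (hle t ht)) ht.le
  have hgt : ∀ᶠ t : ℝ in 𝓝[>] (0:ℝ), 0 < t := self_mem_nhdsWithin
  have hquot : Tendsto (fun t => f t / deriv f t) (𝓝[>] (0:ℝ)) (𝓝 0) := by
    refine tendsto_of_tendsto_of_tendsto_of_le_of_le' tendsto_const_nhds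
      (tendsto_id.mono_left nhdsWithin_le_nhds) ?_ ?_
    · filter_upwards [hgt] with t ht using (div_pos (hpos t ht) (hder t ht)).le
    · filter_upwards [hgt] with t ht using (div_le_iff₀ (hder t ht)).mpr (hle t ht)
  have hsum : p₀⁻¹ + q₀⁻¹ = 1 := by simpa using hpq
  have hpfin : p₀⁻¹ ≠ ⊤ := fun h => by simp [h] at hsum
  have hqfin : q₀⁻¹ ≠ ⊤ := fun h => by simp [h] at hsum
  have hreal : (q₀⁻¹).toReal = 1 - (p₀⁻¹).toReal := by
    rw [eq_sub_iff_add_eq', ← ENNReal.toReal_add hpfin hqfin, hsum, ENNReal.toReal_one]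
  have hinv : Tendsto (fun t => f t * deriv (deriv f) t / deriv f t ^ 2) (𝓝[>] (0:ℝ))
      (𝓝 (1 - (p₀⁻¹).toReal)) := by
    rw [← hreal]
    refine ((ENNReal.tendsto_toReal hqfin).comp (tendsto_inv_iff.mpr hq)).congr' ?_
    filter_upwards [hq.eventually_ne (zero_lt_one.trans_le hq₀1).ne'] with t hqt
    exact inv_qfun_toReal hqt
  have hlim := tendsto_div_mul_deriv_of_tendsto (fun t ht => (hdiff t ht).hasDerivAt)
    (fun t ht => (hdiff' t ht).hasDerivAt) (fun t ht => (hder t ht).ne') hquot hinv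
  have hofReal := tendsto_inv_iff.mpr (ENNReal.tendsto_ofReal hlim)
  rw [ENNReal.ofReal_toReal hpfin, inv_inv] at hofReal
  refine hofReal.congr' ?_
  filter_upwards [hgt] with t ht
  have hft := hpos t ht
  have hdt := hder t ht
  rw [← ENNReal.ofReal_inv_of_pos (by positivity)]
  congr 1
  field_simp
end
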